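/- arXiv:math/0512003 — 3 statements merged into one kernel-verified Lean document; each statement's English description precedes it below -/
import Mathlib

section
/- For any sequence w(k) of positive reals with w(k) → ∞ as k → ∞, there exists a set Λ ⊆ ℤ⁺ of the form Λ = {k² + o(w(k))} — that is, Λ = {a_k : k ≥ 1} for an integer sequence (a_k) with |a_k − k²| = o(w(k)) — such that every measurable function f : 𝕋 → ℂ admits a representation f(t) = ∑_{k∈Λ} c_k e^{ikt} converging in measure, i.e., the partial sums S_N(t) = ∑_{k∈Λ, k≤N} c_k e^{ikt} converge to f in Lebesgue measure on 𝕋. -/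
open MeasureTheory Filter Topology Real

instance : Fact (0 < 2 * π) := ⟨by positivity⟩

/-- The partial sum `S_N(t) = ∑_{k ∈ Λ, 0 < k ≤ N} c_k e^{ikt}` of a series with
spectrum in `Λ ⊆ ℤ⁺`, on the circle `𝕋 = ℝ/2πℤ`. -/
noncomputable def lambdaPartialSum (Λ : Set ℤ) (c : ℤ → ℂ) (N : ℕ)
    (t : AddCircle (2 * π)) : ℂ :=
  ∑ k ∈ Finset.Icc (1 : ℤ) (N : ℤ), Λ.indicator c k * fourier k t


namespace Rep

/-- Smallness in measure. -/
def SM (g : AddCircle (2 * π) → ℂ) (η : ℝ) : Prop :=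
  volume.real {t | η < ‖g t‖} ≤ η

lemma SM.nonneg {g : AddCircle (2 * π) → ℂ} {η : ℝ} (h : SM g η) : 0 ≤ η :=
  measureReal_nonneg.trans h

lemma SM.mono {g : AddCircle (2 * π) → ℂ} {η η' : ℝ} (h : SM g η) (hh : η ≤ η') : SM g η' := by
  refine le_trans (measureReal_mono ?_) (h.trans hh)
  intro t ht
  exact lt_of_le_of_lt hh ht

lemma SM.of_le {g h : AddCircle (2 * π) → ℂ} {η : ℝ} (hh : SM h η) (hg : ∀ t, ‖g t‖ ≤ ‖h t‖) :
    SM g η := by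
  refine le_trans (measureReal_mono ?_) hh
  intro t ht
  exact lt_of_lt_of_le ht (hg t)

lemma SM.of_set {g : AddCircle (2 * π) → ℂ} {η : ℝ} (E : Set (AddCircle (2 * π)))
    (hE : volume.real E ≤ η) (hg : ∀ t, t ∉ E → ‖g t‖ ≤ η) : SM g η := by
  refine le_trans (measureReal_mono ?_) hE
  intro t ht
  by_contra h
  exact absurd ht (not_lt.mpr (hg t h))

lemma SM.of_bound {g : AddCircle (2 * π) → ℂ} {η : ℝ} (h0 : 0 ≤ η)
    (hg : ∀ t, ‖g t‖ ≤ η) : SM g η :=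
  SM.of_set ∅ (by simpa using h0) (fun t _ => hg t)

/-- Triangle inequality. -/
lemma SM.tri {f g h : AddCircle (2 * π) → ℂ} {η η' : ℝ} (hg : SM g η) (hh : SM h η')
    (hf : ∀ t, ‖f t‖ ≤ ‖g t‖ + ‖h t‖) : SM f (η + η') := by
  refine SM.of_set ({t | η < ‖g t‖} ∪ {t | η' < ‖h t‖}) ?_ ?_
  · exact (measureReal_union_le _ _).trans (add_le_add hg hh)
  · intro t ht
    simp only [Set.mem_union, Set.mem_ofPred_eq, not_or, not_lt] at ht
    linarith [hf t, ht.1, ht.2]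

lemma SM.add {g h : AddCircle (2 * π) → ℂ} {η η' : ℝ} (hg : SM g η) (hh : SM h η') :
    SM (fun t => g t + h t) (η + η') :=
  hg.tri hh (fun _ => norm_add_le _ _)

lemma SM.sub {g h : AddCircle (2 * π) → ℂ} {η η' : ℝ} (hg : SM g η) (hh : SM h η') :
    SM (fun t => g t - h t) (η + η') :=
  hg.tri hh (fun _ => norm_sub_le _ _)

lemma SM.zero {η : ℝ} (h : 0 ≤ η) : SM (fun _ => (0 : ℂ)) η :=
  SM.of_bound h (by simpa using h)

lemma vol_univ : (volume : Measure (AddCircle (2 * π))).real Set.univ = 2 * π := by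
  rw [measureReal_def, AddCircle.measure_univ, ENNReal.toReal_ofReal (by positivity)]

/-- Trigonometric polynomial. -/
noncomputable def T (c : ℤ →₀ ℂ) (t : AddCircle (2 * π)) : ℂ :=
  c.sum fun k a => a * fourier k t

/-- Partial sum of trigonometric polynomial. -/
noncomputable def S (n : ℤ) (c : ℤ →₀ ℂ) (t : AddCircle (2 * π)) : ℂ :=
  T (c.filter (· ≤ n)) t

lemma T_zero (t : AddCircle (2 * π)) : T 0 t = 0 := by simp [T]

lemma T_add (c d : ℤ →₀ ℂ) (t : AddCircle (2 * π)) : T (c + d) t = T c t + T d t := by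
  unfold T
  rw [Finsupp.sum_add_index'] <;> intros <;> simp [add_mul]

lemma T_single (k : ℤ) (a : ℂ) (t : AddCircle (2 * π)) :
    T (Finsupp.single k a) t = a * fourier k t := by
  simp [T]

lemma T_finset_sum {ι : Type*} (s : Finset ι) (c : ι → ℤ →₀ ℂ) (t : AddCircle (2 * π)) :
    T (∑ i ∈ s, c i) t = ∑ i ∈ s, T (c i) t := by
  classical
  induction s using Finset.induction_on with
  | empty => simp [T_zero]
  | insert i s hi ih => rw [Finset.sum_insert hi, Finset.sum_insert hi, T_add, ih]

lemma T_continuous (c : ℤ →₀ ℂ) : Continuous (T c) := by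
  unfold T Finsupp.sum
  fun_prop

lemma T_measurable (c : ℤ →₀ ℂ) : Measurable (T c) := (T_continuous c).measurable

lemma S_add (n : ℤ) (c d : ℤ →₀ ℂ) (t : AddCircle (2 * π)) :
    S n (c + d) t = S n c t + S n d t := by
  unfold S
  rw [Finsupp.filter_add, T_add]

lemma S_zero (n : ℤ) (t : AddCircle (2 * π)) : S n 0 t = 0 := by
  unfold S
  rw [Finsupp.filter_zero, T_zero]

lemma S_eq_T {n : ℤ} {c : ℤ →₀ ℂ} (h : ∀ k ∈ c.support, k ≤ n) (t : AddCircle (2 * π)) :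
    S n c t = T c t := by
  unfold S
  rw [Finsupp.filter_eq_self_iff _ c |>.2]
  intro k hk
  exact h k (by simpa using hk)

lemma S_eq_zero {n : ℤ} {c : ℤ →₀ ℂ} (h : ∀ k ∈ c.support, n < k) (t : AddCircle (2 * π)) :
    S n c t = 0 := by
  unfold S
  rw [(Finsupp.filter_eq_zero_iff _ c).2, T_zero]
  intro k hk
  by_contra h0
  exact absurd hk (not_le.mpr (h k (by simpa using h0)))

lemma S_concat_le {n N : ℤ} {c d : ℤ →₀ ℂ} (hd : ∀ k ∈ d.support, N < k) (hn : n ≤ N)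
    (t : AddCircle (2 * π)) : S n (c + d) t = S n c t := by
  rw [S_add, S_eq_zero (c := d) (fun k hk => lt_of_le_of_lt hn (hd k hk)), add_zero]

lemma S_concat_ge {n N : ℤ} {c d : ℤ →₀ ℂ} (hc : ∀ k ∈ c.support, k ≤ N) (hn : N ≤ n)
    (t : AddCircle (2 * π)) : S n (c + d) t = T c t + S n d t := by
  rw [S_add, S_eq_T (c := c) (fun k hk => (hc k hk).trans hn)]

lemma exists_bound (c : ℤ →₀ ℂ) (N : ℕ) : ∃ N' : ℕ, N ≤ N' ∧ ∀ k ∈ c.support, k ≤ (N' : ℤ) := by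
  refine ⟨max N (∑ k ∈ c.support, k.natAbs), le_max_left _ _, fun k hk => ?_⟩
  have : k.natAbs ≤ ∑ k ∈ c.support, k.natAbs :=
    Finset.single_le_sum (f := fun k : ℤ => k.natAbs) (fun _ _ => Nat.zero_le _) hk
  have h2 := le_max_right N (∑ k ∈ c.support, k.natAbs)
  omega

lemma norm_fourier (k : ℤ) (t : AddCircle (2 * π)) : ‖(fourier k t : ℂ)‖ = 1 := by
  rw [fourier_apply]; exact Circle.norm_coe _

/-- Parseval for polynomials. -/
lemma parseval (c : ℤ →₀ ℂ) :
    ∫ t, ‖T c t‖ ^ 2 ∂(volume : Measure (AddCircle (2 * π))) =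
      2 * π * ∑ k ∈ c.support, ‖c k‖ ^ 2 := by
  let F : C(AddCircle (2 * π), ℂ) := ∑ k ∈ c.support, c k • fourier k
  have hF : ∀ t, F t = T c t := by
    intro t
    simp [F, T, Finsupp.sum]
  have h1 : ContinuousMap.toLp (E := ℂ) 2 (@AddCircle.haarAddCircle (2 * π) _) ℂ F
      = ∑ k ∈ c.support, c k • fourierLp 2 k := by
    simp [F, map_sum]
  have h2 := (@orthonormal_fourier (2 * π) _).inner_sum c c c.support
  rw [← h1, ContinuousMap.inner_toLp] at h2
  have h3 : ∫ t, ((‖T c t‖ ^ 2 : ℝ) : ℂ) ∂(@AddCircle.haarAddCircle (2 * π) _) =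
      ((∑ k ∈ c.support, ‖c k‖ ^ 2 : ℝ) : ℂ) := by
    push_cast
    rw [← Finset.sum_congr rfl (fun k _ => Complex.conj_mul' (c k)), ← h2]
    congr 1
    ext t
    rw [hF, Complex.mul_conj']
  rw [integral_complex_ofReal, Complex.ofReal_inj, AddCircle.integral_haarAddCircle, smul_eq_mul] at h3
  rw [← h3]
  field_simp

lemma SM_of_sq {c : ℤ →₀ ℂ} {η : ℝ} (hη : 0 < η)
    (h : ∑ k ∈ c.support, ‖c k‖ ^ 2 ≤ η ^ 3 / (2 * π)) : SM (T c) η := by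
  have h1 := mul_meas_ge_le_integral_of_nonneg (μ := (volume : Measure (AddCircle (2 * π))))
    (f := fun t => ‖T c t‖ ^ 2) (Eventually.of_forall fun t => by positivity)
    ((T_continuous c).norm.pow 2 |>.integrable_of_hasCompactSupport
      (HasCompactSupport.of_compactSpace _)) (η ^ 2)
  rw [parseval] at h1
  have h2 : volume.real {t | η < ‖T c t‖} ≤ volume.real {t | η ^ 2 ≤ ‖T c t‖ ^ 2} := by
    refine measureReal_mono ?_
    intro t ht
    exact pow_le_pow_left₀ hη.le (le_of_lt ht) 2
  have h3 : 2 * π * ∑ k ∈ c.support, ‖c k‖ ^ 2 ≤ η ^ 3 := by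
    rw [le_div_iff₀ (by positivity)] at h
    linarith
  have h4 : η ^ 2 * volume.real {t | η < ‖T c t‖} ≤ η ^ 2 * η := by
    nlinarith [mul_le_mul_of_nonneg_left h2 (sq_nonneg η)]
  exact le_of_mul_le_mul_left h4 (by positivity)

end Rep


namespace Rep

lemma memLp_of_bound {Q : AddCircle (2 * π) → ℂ} {γ : ℝ} (hm : Measurable Q)
    (hb : ∀ t, ‖Q t‖ ≤ γ) : MemLp Q 2 (@AddCircle.haarAddCircle (2 * π) _) :=
  MemLp.of_bound hm.aestronglyMeasurable γ (Eventually.of_forall hb)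

lemma bessel {Q : AddCircle (2 * π) → ℂ} {γ : ℝ} (hm : Measurable Q)
    (hb : ∀ t, ‖Q t‖ ≤ γ) (s : Finset ℤ) : ∑ k ∈ s, ‖fourierCoeff Q k‖ ^ 2 ≤ γ ^ 2 := by
  have hL := memLp_of_bound hm hb
  have h := hasSum_sq_fourierCoeff hL.toLp
  rw [fourierCoeff_congr_ae hL.coeFn_toLp] at h
  refine (sum_le_hasSum s (fun _ _ => by positivity) h).trans ?_
  have h1 : ∫ t, ‖(hL.toLp Q) t‖ ^ 2 ∂(@AddCircle.haarAddCircle (2 * π) _)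
      ≤ ∫ t, γ ^ 2 ∂(@AddCircle.haarAddCircle (2 * π) _) := by
    refine integral_mono_of_nonneg (Eventually.of_forall fun t => by positivity)
      (integrable_const _) ?_
    filter_upwards [hL.coeFn_toLp] with t ht
    rw [ht]
    exact pow_le_pow_left₀ (norm_nonneg _) (hb t) 2
  simpa using h1

lemma fourierCoeff_tendsto {Q : AddCircle (2 * π) → ℂ} {γ : ℝ} (hm : Measurable Q)
    (hb : ∀ t, ‖Q t‖ ≤ γ) : Tendsto (fourierCoeff Q) cofinite (𝓝 0) := by
  have hL := memLp_of_bound hm hb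
  have h := (hasSum_sq_fourierCoeff hL.toLp).summable.tendsto_cofinite_zero
  rw [fourierCoeff_congr_ae hL.coeFn_toLp] at h
  rw [tendsto_zero_iff_norm_tendsto_zero]
  have h2 := h.sqrt
  simpa [Real.sqrt_sq] using h2

lemma exists_poly {Q : AddCircle (2 * π) → ℂ} {γ : ℝ} (hm : Measurable Q)
    (hb : ∀ t, ‖Q t‖ ≤ γ) {η : ℝ} (hη : 0 < η) :
    ∃ q : ℤ →₀ ℂ, ∑ k ∈ q.support, ‖q k‖ ^ 2 ≤ γ ^ 2 ∧ SM (fun t => T q t - Q t) η := by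
  classical
  have hL := memLp_of_bound hm hb
  have h := hasSum_fourier_series_L2 hL.toLp
  rw [fourierCoeff_congr_ae hL.coeFn_toLp] at h
  have h1 := tendstoInMeasure_of_tendsto_Lp h
  rw [tendstoInMeasure_iff_measureReal_norm] at h1
  have h2 := (h1 η hη).eventually (gt_mem_nhds (show (0:ℝ) < η / (2 * π) by positivity))
  obtain ⟨s, hs⟩ := h2.exists
  let q : ℤ →₀ ℂ := Finsupp.onFinset s (fun k => if k ∈ s then fourierCoeff Q k else 0)
    (by intro k hk; by_contra h; simp [h] at hk)
  have hqs : q.support ⊆ s := Finsupp.support_onFinset_subset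
  have hqv : ∀ k ∈ s, q k = fourierCoeff Q k := by
    intro k hk; simp [q, hk]
  refine ⟨q, ?_, ?_⟩
  · calc ∑ k ∈ q.support, ‖q k‖ ^ 2 = ∑ k ∈ q.support, ‖fourierCoeff Q k‖ ^ 2 :=
          Finset.sum_congr rfl (fun k hk => by rw [hqv k (hqs hk)])
      _ ≤ γ ^ 2 := bessel hm hb _
  · have hT : ∀ t, T q t = ∑ k ∈ s, fourierCoeff Q k * fourier k t := by
      intro t
      unfold T
      rw [Finsupp.sum_of_support_subset _ hqs _ (by simp)]
      exact Finset.sum_congr rfl (fun k hk => by rw [hqv k hk])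
    have hae : ⇑(∑ k ∈ s, fourierCoeff Q k • fourierLp (T := 2 * π) 2 k)
        =ᵐ[AddCircle.haarAddCircle] T q := by
      have : (∑ k ∈ s, fourierCoeff Q k • fourierLp (T := 2 * π) 2 k) =
          ContinuousMap.toLp (E := ℂ) 2 (@AddCircle.haarAddCircle (2 * π) _) ℂ
            (∑ k ∈ s, fourierCoeff Q k • fourier k) := by
        simp [map_sum]
      rw [this]
      refine (ContinuousMap.coeFn_toLp _ _).trans (Eventually.of_forall fun t => ?_)
      simp [hT]
    have hmeas : (@AddCircle.haarAddCircle (2 * π) _).real {t | η ≤ ‖T q t - Q t‖} ≤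
        η / (2 * π) := by
      refine le_trans (le_of_eq ?_) hs.le
      refine measureReal_congr ?_
      filter_upwards [hae, hL.coeFn_toLp] with t h1 h2
      apply propext
      change η ≤ _ ↔ η ≤ _
      rw [h1, h2]
    unfold SM
    rw [AddCircle.volume_eq_smul_haarAddCircle, measureReal_ennreal_smul_apply,
      ENNReal.toReal_ofReal (by positivity)]
    rw [le_div_iff₀ (by positivity)] at hmeas
    refine le_trans ?_ hmeas
    rw [mul_comm]
    gcongr
    · finiteness
    · exact fun h => le_of_lt h

/-- Deviation functional for equidistribution. -/
noncomputable def Dev (a : AddCircle (2 * π) → ℂ) (M : ℕ) (ψ : C(AddCircle (2 * π), ℂ)) : ℂ :=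
  (∫ t, a t * ψ ((M : ℤ) • t)) - (2 * π)⁻¹ * (∫ t, a t) * ∫ t, ψ t

lemma int_of_bound {a : AddCircle (2 * π) → ℂ} {γ : ℝ} (hm : Measurable a)
    (hb : ∀ t, ‖a t‖ ≤ γ) : Integrable a :=
  Integrable.of_bound hm.aestronglyMeasurable γ (Eventually.of_forall hb)

lemma int_mul_comp {a : AddCircle (2 * π) → ℂ} {γ : ℝ} (hm : Measurable a)
    (hb : ∀ t, ‖a t‖ ≤ γ) (M : ℕ) (ψ : C(AddCircle (2 * π), ℂ)) :
    Integrable (fun t => a t * ψ ((M : ℤ) • t)) := by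
  refine int_of_bound (γ := γ * ‖ψ‖) ?_ ?_
  · exact hm.mul ((ψ.continuous.comp (continuous_zsmul (M : ℤ))).measurable)
  · intro t
    rw [norm_mul]
    have h0 : 0 ≤ γ := (norm_nonneg _).trans (hb t)
    exact mul_le_mul (hb t) (ψ.norm_coe_le_norm _) (norm_nonneg _) h0

lemma Dev_bound {a : AddCircle (2 * π) → ℂ} {γ : ℝ} (hm : Measurable a)
    (hb : ∀ t, ‖a t‖ ≤ γ) (M : ℕ) (ψ : C(AddCircle (2 * π), ℂ)) :
    ‖Dev a M ψ‖ ≤ 4 * π * γ * ‖ψ‖ := by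
  have h0 : 0 ≤ γ := (norm_nonneg _).trans (hb 0)
  have e1 : ‖∫ t, a t * ψ ((M : ℤ) • t)‖ ≤ (γ * ‖ψ‖) * (volume : Measure (AddCircle (2 * π))).real Set.univ := by
    refine norm_integral_le_of_norm_le_const (Eventually.of_forall fun t => ?_)
    rw [norm_mul]
    exact mul_le_mul (hb t) (ψ.norm_coe_le_norm _) (norm_nonneg _) h0
  have e2 : ‖∫ t, a t‖ ≤ γ * (volume : Measure (AddCircle (2 * π))).real Set.univ := by
    exact norm_integral_le_of_norm_le_const (Eventually.of_forall hb)
  have e3 : ‖∫ t, ψ t‖ ≤ ‖ψ‖ * (volume : Measure (AddCircle (2 * π))).real Set.univ := by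
    exact norm_integral_le_of_norm_le_const (Eventually.of_forall ψ.norm_coe_le_norm)
  rw [vol_univ] at e1 e2 e3
  unfold Dev
  refine (norm_sub_le _ _).trans ?_
  rw [norm_mul, norm_mul]
  have e4 : ‖(((2 * π)⁻¹ : ℝ) : ℂ)‖ = (2 * π)⁻¹ := by
    rw [Complex.norm_real, Real.norm_of_nonneg (by positivity)]
  rw [e4]
  have e5 : (2 * π)⁻¹ * ‖∫ t, a t‖ * ‖∫ t, ψ t‖ ≤ (2 * π)⁻¹ * (γ * (2 * π)) * (‖ψ‖ * (2 * π)) := by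
    gcongr
  have e6 : (2 * π)⁻¹ * (γ * (2 * π)) * (‖ψ‖ * (2 * π)) = γ * ‖ψ‖ * (2 * π) := by
    field_simp
  linarith

lemma Dev_add {a : AddCircle (2 * π) → ℂ} {γ : ℝ} (hm : Measurable a)
    (hb : ∀ t, ‖a t‖ ≤ γ) (M : ℕ) (ψ φ : C(AddCircle (2 * π), ℂ)) :
    Dev a M (ψ + φ) = Dev a M ψ + Dev a M φ := by
  have hi : ∀ ψ : C(AddCircle (2 * π), ℂ), Integrable (fun t => ψ t) := fun ψ =>
    int_of_bound ψ.continuous.measurable ψ.norm_coe_le_norm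
  unfold Dev
  simp only [ContinuousMap.add_apply, mul_add]
  rw [integral_add (int_mul_comp hm hb M ψ) (int_mul_comp hm hb M φ), integral_add (hi ψ) (hi φ)]
  ring

lemma Dev_smul {a : AddCircle (2 * π) → ℂ} (M : ℕ) (z : ℂ) (ψ : C(AddCircle (2 * π), ℂ)) :
    Dev a M (z • ψ) = z * Dev a M ψ := by
  unfold Dev
  simp only [ContinuousMap.smul_apply, smul_eq_mul, mul_left_comm _ z, integral_const_mul]
  ring

lemma integral_fourier {k : ℤ} (hk : k ≠ 0) : ∫ t : AddCircle (2 * π), fourier k t = 0 :=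
  integral_eq_zero_of_add_right_eq_neg (μ := volume)
      (fourier_add_half_inv_index hk (by positivity))

lemma fourier_zsmul' (k M : ℤ) (t : AddCircle (2 * π)) :
    (fourier k (M • t) : ℂ) = fourier (k * M) t := by
  rw [fourier_apply, fourier_apply, smul_smul]

lemma Dev_fourier {a : AddCircle (2 * π) → ℂ} {γ : ℝ} (hm : Measurable a)
    (hb : ∀ t, ‖a t‖ ≤ γ) (k : ℤ) :
    Tendsto (fun M => Dev a M (fourier k)) atTop (𝓝 0) := by
  by_cases hk : k = 0
  · subst hk
    have : ∀ M, Dev a M (fourier 0) = 0 := by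
      intro M
      unfold Dev
      have hp : (π : ℂ) ≠ 0 := by exact_mod_cast pi_pos.ne'
      simp [vol_univ]
      field_simp
      simp
    simp [this]
  · have h1 : ∀ M, Dev a M (fourier k) = (2 * π) * fourierCoeff a (-(k * M)) := by
      intro M
      unfold Dev fourierCoeff
      rw [integral_fourier hk, mul_zero, sub_zero, AddCircle.integral_haarAddCircle]
      have hp : (π : ℂ) ≠ 0 := by exact_mod_cast pi_pos.ne'
      simp only [fourier_zsmul', neg_neg, smul_eq_mul, Complex.real_smul]
      push_cast
      field_simp
      exact integral_congr_ae (Eventually.of_forall fun t => mul_comm _ _)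
    simp only [h1]
    have h2 : Tendsto (fun M : ℕ => fourierCoeff a (-(k * M))) atTop (𝓝 0) := by
      refine (fourierCoeff_tendsto hm hb).comp ?_
      rw [← Nat.cofinite_eq_atTop]
      refine Function.Injective.tendsto_cofinite ?_
      intro x y hxy
      simpa [hk] using hxy
    simpa using h2.const_mul (2 * π : ℂ)

lemma Dev_tendsto {a : AddCircle (2 * π) → ℂ} {γ : ℝ} (hm : Measurable a)
    (hb : ∀ t, ‖a t‖ ≤ γ) (ψ : C(AddCircle (2 * π), ℂ)) :
    Tendsto (fun M => Dev a M ψ) atTop (𝓝 0) := by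
  have hspan : ∀ p ∈ Submodule.span ℂ (Set.range (@fourier (2 * π))),
      Tendsto (fun M => Dev a M p) atTop (𝓝 0) := by
    intro p hp
    induction hp using Submodule.span_induction with
    | mem x hx => obtain ⟨k, rfl⟩ := hx; exact Dev_fourier hm hb k
    | zero =>
      have : ∀ M, Dev a M 0 = 0 := by intro M; simp [Dev]
      simp [this]
    | add x y _ _ hx hy => simpa [Dev_add hm hb] using hx.add hy
    | smul z x _ hx => simpa [Dev_smul] using hx.const_mul z
  have hcl : ψ ∈ closure (Submodule.span ℂ (Set.range (@fourier (2 * π))) : Set _) := by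
    have := @span_fourier_closure_eq_top (2 * π) _
    rw [← Submodule.topologicalClosure_coe, this]
    trivial
  have h0 : 0 ≤ γ := (norm_nonneg _).trans (hb 0)
  rw [Metric.tendsto_nhds]
  intro ε hε
  obtain ⟨p, hp, hd⟩ := Metric.mem_closure_iff.1 hcl (ε / 2 / (4 * π * γ + 1)) (by positivity)
  filter_upwards [(Metric.tendsto_nhds.1 (hspan p hp)) (ε / 2) (by positivity)] with M hM
  rw [dist_zero_right] at hM ⊢
  have e1 : Dev a M ψ = Dev a M p + Dev a M (ψ - p) := by
    rw [← Dev_add hm hb]; congr 1; simp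
  rw [e1]
  refine lt_of_le_of_lt (norm_add_le _ _) ?_
  have e2 := Dev_bound hm hb M (ψ - p)
  rw [dist_eq_norm, lt_div_iff₀ (by positivity)] at hd
  nlinarith [norm_nonneg (ψ - p)]

/-- Equidistribution. -/
lemma equidist {a : AddCircle (2 * π) → ℝ} {γ : ℝ} (hm : Measurable a)
    (hb : ∀ t, |a t| ≤ γ) {ψ : AddCircle (2 * π) → ℝ} (hψ : Continuous ψ) :
    Tendsto (fun M : ℕ => ∫ t, a t * ψ ((M : ℤ) • t)) atTop
      (𝓝 ((2 * π)⁻¹ * (∫ t, a t) * ∫ t, ψ t)) := by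
  have h := Dev_tendsto (a := fun t => (a t : ℂ)) (γ := γ) (by fun_prop)
    (by simpa using hb) ⟨fun t => (ψ t : ℂ), by fun_prop⟩
  unfold Dev at h
  simp only [ContinuousMap.coe_mk] at h
  simp only [← Complex.ofReal_mul, integral_complex_ofReal] at h
  have h2 := (Complex.continuous_re.tendsto _).comp h
  rw [tendsto_iff_norm_sub_tendsto_zero]
  have h3 := h2.norm
  simp only [Complex.zero_re, norm_zero] at h3
  refine h3.congr fun M => ?_
  simp only [Function.comp]
  congr 1

end Rep


namespace Rep

/-- The logarithmic increment. -/
noncomputable def xi (g : ℝ) (y : AddCircle (2 * π)) : ℝ := log ‖1 - (g : ℂ) * fourier 1 y‖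

lemma xi_lower {g : ℝ} (g0 : 0 ≤ g) (g1 : g ≤ 1 / 2) (y : AddCircle (2 * π)) :
    1 / 2 ≤ ‖1 - (g : ℂ) * fourier 1 y‖ := by
  have h := norm_sub_norm_le (1 : ℂ) ((g : ℂ) * fourier 1 y)
  rw [norm_mul, norm_fourier, Complex.norm_real, Real.norm_of_nonneg g0, norm_one] at h
  linarith

lemma xi_continuous {g : ℝ} (g0 : 0 ≤ g) (g1 : g ≤ 1 / 2) : Continuous (xi g) := by
  unfold xi
  refine Continuous.log (by fun_prop) ?_
  intro y
  have := xi_lower g0 g1 y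
  linarith

lemma xi_integral {g : ℝ} (g0 : 0 ≤ g) (g1 : g ≤ 1 / 2) : ∫ y, xi g y = 0 := by
  have h := circleAverage_log_norm_sub_const₀ (a := (g : ℂ)) (by
    rw [Complex.norm_real, Real.norm_of_nonneg g0]; linarith)
  rw [circleAverage_def] at h
  have h2 : ∫ θ in (0 : ℝ)..2 * π, log ‖circleMap 0 1 θ - (g : ℂ)‖ = 0 := by
    have hp : (2 * π)⁻¹ ≠ 0 := by positivity
    simpa [hp] using h
  rw [← AddCircle.intervalIntegral_preimage (2 * π) 0 (xi g), zero_add]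
  refine Eq.trans ?_ h2
  apply intervalIntegral.integral_congr
  intro θ _
  simp only [xi]
  congr 1
  have hz : (fourier 1 (θ : AddCircle (2 * π)) : ℂ) = circleMap 0 1 θ := by
    rw [fourier_coe_apply, circleMap]
    have hp : (π : ℂ) ≠ 0 := by exact_mod_cast pi_pos.ne'
    simp
    congr 1
    field_simp
  rw [hz]
  set z := circleMap 0 1 θ with hzd
  have hz1 : ‖z‖ = 1 := by simp [hzd]
  have hzz : z * (starRingEnd ℂ) z = 1 := by
    rw [Complex.mul_conj', hz1]; simp
  have : 1 - (g : ℂ) * z = z * (starRingEnd ℂ) (z - g) := by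
    rw [map_sub, Complex.conj_ofReal, mul_sub, hzz]; ring
  rw [this, norm_mul, hz1, one_mul, RCLike.norm_conj]

lemma xi_sq_pos {g : ℝ} (g0 : 0 < g) (g1 : g ≤ 1 / 2) : 0 < ∫ y, xi g y ^ 2 := by
  refine Continuous.integral_pos_of_hasCompactSupport_nonneg_nonzero (x := 0)
    ((xi_continuous g0.le g1).pow 2) (HasCompactSupport.of_compactSpace _)
    (fun y => sq_nonneg _) ?_
  refine pow_ne_zero 2 ?_
  unfold xi
  rw [fourier_eval_zero, mul_one]
  have : ‖(1 : ℂ) - g‖ = 1 - g := by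
    rw [← Complex.ofReal_one, ← Complex.ofReal_sub, Complex.norm_real, Real.norm_of_nonneg]
    linarith
  rw [this]
  exact (Real.log_neg (by linarith) (by linarith)).ne

/-- The building block property. -/
def BP (Λ : Set ℤ) : Prop :=
  ∀ η : ℝ, 0 < η → ∃ γ : ℝ, 0 < γ ∧ ∀ Q : AddCircle (2 * π) → ℂ, Measurable Q →
    (∀ t, ‖Q t‖ ≤ γ) → ∀ η' : ℝ, 0 < η' → ∀ N : ℕ, ∃ᶠ M : ℕ in atTop, ∃ c : ℤ →₀ ℂ,
      (∀ k ∈ c.support, k ∈ Λ ∧ (N : ℤ) < k) ∧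
      SM (fun t => T c t - fourier (M : ℤ) t * Q t) η' ∧ ∀ n, SM (S n c) η

lemma SM_S_of_sq {c : ℤ →₀ ℂ} {η : ℝ} (hη : 0 < η)
    (h : ∑ k ∈ c.support, ‖c k‖ ^ 2 ≤ η ^ 3 / (2 * π)) (n : ℤ) : SM (S n c) η := by
  refine SM_of_sq hη (le_trans ?_ h)
  rw [Finsupp.support_filter]
  calc ∑ k ∈ c.support with k ≤ n, ‖(c.filter (· ≤ n)) k‖ ^ 2
      = ∑ k ∈ c.support with k ≤ n, ‖c k‖ ^ 2 := by
        refine Finset.sum_congr rfl fun k hk => ?_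
        rw [Finsupp.filter_apply_pos (fun x => x ≤ n) _ (Finset.mem_filter.1 hk).2]
    _ ≤ _ := Finset.sum_le_sum_of_subset_of_nonneg (Finset.filter_subset _ _)
        (fun _ _ _ => by positivity)

lemma S_single (n k : ℤ) (a : ℂ) (t : AddCircle (2 * π)) :
    S n (Finsupp.single k a) t = if k ≤ n then a * fourier k t else 0 := by
  unfold S
  split_ifs with h
  · rw [Finsupp.filter_single_of_pos (p := fun x => x ≤ n) h, T_single]
  · rw [Finsupp.filter_single_of_neg (p := fun x => x ≤ n) h, T_zero]

lemma T_shift (M : ℤ) (q : ℤ →₀ ℂ) (t : AddCircle (2 * π)) :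
    T (q.mapDomain (· + M)) t = fourier M t * T q t := by
  induction q using Finsupp.induction_linear with
  | zero => simp [T_zero]
  | add f g hf hg => rw [Finsupp.mapDomain_add, T_add, T_add, hf, hg]; ring
  | single k a => rw [Finsupp.mapDomain_single, T_single, T_single, fourier_add]; ring

lemma S_shift (n M : ℤ) (q : ℤ →₀ ℂ) (t : AddCircle (2 * π)) :
    S n (q.mapDomain (· + M)) t = fourier M t * S (n - M) q t := by
  induction q using Finsupp.induction_linear with
  | zero => simp [S_zero]
  | add f g hf hg => rw [Finsupp.mapDomain_add, S_add, S_add, hf, hg]; ring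
  | single k a =>
    rw [Finsupp.mapDomain_single, S_single, S_single, fourier_add]
    by_cases h : k + M ≤ n
    · rw [if_pos h, if_pos (by omega)]; ring
    · rw [if_neg h, if_neg (by omega)]; ring

lemma exists_lower (c : ℤ →₀ ℂ) (N : ℕ) : ∃ N' : ℕ, N ≤ N' ∧ ∀ k ∈ c.support, -(N' : ℤ) ≤ k := by
  refine ⟨max N (∑ k ∈ c.support, k.natAbs), le_max_left _ _, fun k hk => ?_⟩
  have : k.natAbs ≤ ∑ k ∈ c.support, k.natAbs :=
    Finset.single_le_sum (f := fun k : ℤ => k.natAbs) (fun _ _ => Nat.zero_le _) hk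
  have h2 := le_max_right N (∑ k ∈ c.support, k.natAbs)
  omega

/-- Given `η`, a good `γ`. -/
lemma exists_gamma {η : ℝ} (hη : 0 < η) : ∃ γ : ℝ, 0 < γ ∧ γ ≤ 1 ∧ γ ^ 2 ≤ η ^ 3 / (2 * π) := by
  refine ⟨min 1 (η ^ 3 / (2 * π)), by positivity, min_le_left _ _, ?_⟩
  have h1 : min 1 (η ^ 3 / (2 * π)) ≤ 1 := min_le_left _ _
  have h2 : min 1 (η ^ 3 / (2 * π)) ≤ (η ^ 3 / (2 * π)) := min_le_right _ _
  have h3 : 0 < min 1 (η ^ 3 / (2 * π)) := by positivity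
  nlinarith

lemma BP_pos : BP {k : ℤ | 0 < k} := by
  intro η hη
  obtain ⟨γ, hγ, -, hγ2⟩ := exists_gamma hη
  refine ⟨γ, hγ, fun Q hQ hb η' hη' N => ?_⟩
  obtain ⟨q, hq1, hq2⟩ := exists_poly hQ hb hη'
  obtain ⟨N', -, hN'⟩ := exists_lower q N
  refine Eventually.frequently ?_
  filter_upwards [eventually_gt_atTop (N + N')] with M hM
  refine ⟨q.mapDomain (· + (M : ℤ)), ?_, ?_, ?_⟩
  · intro k hk
    classical
    have := Finsupp.mapDomain_support hk
    rw [Finset.mem_image] at this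
    obtain ⟨j, hj, rfl⟩ := this
    have := hN' j hj
    refine ⟨?_, by omega⟩
    omega
  · refine hq2.of_le fun t => ?_
    rw [T_shift, ← mul_sub, norm_mul, norm_fourier, one_mul]
  · intro n
    refine (SM_S_of_sq hη (hq1.trans hγ2) (n - M)).of_le fun t => ?_
    rw [S_shift, norm_mul, norm_fourier, one_mul]

end Rep


namespace Rep

/-- Truncated logarithm of the size. -/
noncomputable def ell (ε : ℝ) (ρ : AddCircle (2 * π) → ℂ) (t : AddCircle (2 * π)) : ℝ :=
  max 0 (log (‖ρ t‖ / ε))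

lemma ell_nonneg (ε : ℝ) (ρ : AddCircle (2 * π) → ℂ) (t : AddCircle (2 * π)) : 0 ≤ ell ε ρ t :=
  le_max_left _ _

lemma ell_measurable (ε : ℝ) {ρ : AddCircle (2 * π) → ℂ} (h : Measurable ρ) :
    Measurable (ell ε ρ) :=
  measurable_const.max (Real.measurable_log.comp (h.norm.div_const ε))

lemma ell_le {ε W : ℝ} (hε : 0 < ε) {ρ : AddCircle (2 * π) → ℂ} {t : AddCircle (2 * π)}
    (h : ‖ρ t‖ ≤ W) : ell ε ρ t ≤ max 0 (log (W / ε)) := by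
  unfold ell
  refine max_le (le_max_left _ _) ?_
  rcases (norm_nonneg (ρ t)).eq_or_lt with h0 | h0
  · rw [← h0]; simp
  · refine le_trans (Real.log_le_log (by positivity) ?_) (le_max_right _ _)
    gcongr

/-- The active set. -/
def Uset (ε K : ℝ) (ρ : AddCircle (2 * π) → ℂ) : Set (AddCircle (2 * π)) :=
  {t | 2 * ε ≤ ‖ρ t‖ ∧ ‖ρ t‖ ≤ K}

lemma Uset_measurable (ε K : ℝ) {ρ : AddCircle (2 * π) → ℂ} (h : Measurable ρ) :
    MeasurableSet (Uset ε K ρ) :=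
  (measurableSet_le measurable_const h.norm).inter (measurableSet_le h.norm measurable_const)

/-- The correction. -/
noncomputable def Qf (ε K g : ℝ) (ρ : AddCircle (2 * π) → ℂ) (t : AddCircle (2 * π)) : ℂ :=
  (Uset ε K ρ).indicator (fun t => (g : ℂ) * ρ t) t

lemma Qf_measurable (ε K g : ℝ) {ρ : AddCircle (2 * π) → ℂ} (h : Measurable ρ) :
    Measurable (Qf ε K g ρ) :=
  (h.const_mul (g : ℂ)).indicator (Uset_measurable ε K h)

lemma Qf_bound {ε K g γ : ℝ} (hg : 0 ≤ g) (hγ : 0 ≤ γ) (hK : g * K ≤ γ)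
    (ρ : AddCircle (2 * π) → ℂ) (t : AddCircle (2 * π)) : ‖Qf ε K g ρ t‖ ≤ γ := by
  unfold Qf
  by_cases ht : t ∈ Uset ε K ρ
  · rw [Set.indicator_of_mem ht, norm_mul, Complex.norm_real, Real.norm_of_nonneg hg]
    exact (mul_le_mul_of_nonneg_left ht.2 hg).trans hK
  · rw [Set.indicator_of_notMem ht]; simpa using hγ

/-- The new remainder. -/
noncomputable def nxt (ε K g : ℝ) (M : ℕ) (ρ : AddCircle (2 * π) → ℂ) (t : AddCircle (2 * π)) : ℂ :=
  ρ t - fourier (M : ℤ) t * Qf ε K g ρ t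

lemma nxt_measurable (ε K g : ℝ) (M : ℕ) {ρ : AddCircle (2 * π) → ℂ} (h : Measurable ρ) :
    Measurable (nxt ε K g M ρ) :=
  h.sub ((fourier (M : ℤ)).continuous.measurable.mul (Qf_measurable ε K g h))

lemma nxt_mem {ε K g : ℝ} (M : ℕ) {ρ : AddCircle (2 * π) → ℂ} {t : AddCircle (2 * π)}
    (ht : t ∈ Uset ε K ρ) :
    ‖nxt ε K g M ρ t‖ = ‖ρ t‖ * ‖1 - (g : ℂ) * fourier 1 ((M : ℤ) • t)‖ := by
  unfold nxt Qf
  rw [Set.indicator_of_mem ht, ← norm_mul, fourier_zsmul', one_mul]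
  congr 1
  ring

lemma nxt_notMem {ε K g : ℝ} (M : ℕ) {ρ : AddCircle (2 * π) → ℂ} {t : AddCircle (2 * π)}
    (ht : t ∉ Uset ε K ρ) : nxt ε K g M ρ t = ρ t := by
  unfold nxt Qf
  rw [Set.indicator_of_notMem ht]; simp

lemma nxt_bound {ε K g W : ℝ} (g0 : 0 ≤ g) (g1 : g ≤ 1 / 2) (hW : 2 * K ≤ W) (M : ℕ)
    {ρ : AddCircle (2 * π) → ℂ} (hρ : ∀ t, ‖ρ t‖ ≤ W) (t : AddCircle (2 * π)) :
    ‖nxt ε K g M ρ t‖ ≤ W := by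
  by_cases ht : t ∈ Uset ε K ρ
  · rw [nxt_mem M ht]
    have h1 : ‖1 - (g : ℂ) * fourier 1 ((M : ℤ) • t)‖ ≤ 2 := by
      refine (norm_sub_le _ _).trans ?_
      rw [norm_mul, norm_fourier, Complex.norm_real, Real.norm_of_nonneg g0, norm_one]
      linarith
    have h2 := ht.2
    have h3 := norm_nonneg (ρ t)
    nlinarith
  · rw [nxt_notMem M ht]; exact hρ t

lemma ell_nxt {ε K g : ℝ} (hε : 0 < ε) (g0 : 0 ≤ g) (g1 : g ≤ 1 / 2) (M : ℕ)
    (ρ : AddCircle (2 * π) → ℂ) (t : AddCircle (2 * π)) :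
    ell ε (nxt ε K g M ρ) t =
      ell ε ρ t + (Uset ε K ρ).indicator (fun _ => (1 : ℝ)) t * xi g ((M : ℤ) • t) := by
  by_cases ht : t ∈ Uset ε K ρ
  · rw [Set.indicator_of_mem ht, one_mul]
    have hx := xi_lower g0 g1 ((M : ℤ) • t)
    have h1 : 2 * ε ≤ ‖ρ t‖ := ht.1
    unfold ell xi
    rw [nxt_mem M ht, max_eq_right, max_eq_right, mul_div_right_comm, Real.log_mul]
    · have : 0 < ‖ρ t‖ := by linarith
      positivity
    · linarith
    · apply Real.log_nonneg
      rw [le_div_iff₀ hε]; linarith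
    · apply Real.log_nonneg
      rw [le_div_iff₀ hε]; nlinarith
  · rw [Set.indicator_of_notMem ht, zero_mul, add_zero]
    unfold ell
    rw [nxt_notMem M ht]

/-- Weighted integral of `ell`. -/
noncomputable def Iell (d : AddCircle (2 * π) → ℝ) (ε : ℝ) (ρ : AddCircle (2 * π) → ℂ) : ℝ :=
  ∫ t, d t * ell ε ρ t

lemma rint {a : AddCircle (2 * π) → ℝ} {γ : ℝ} (hm : Measurable a)
    (hb : ∀ t, |a t| ≤ γ) : Integrable a :=
  Integrable.of_bound hm.aestronglyMeasurable γ (Eventually.of_forall hb)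

lemma ell_abs {ε W : ℝ} (hε : 0 < ε) {ρ : AddCircle (2 * π) → ℂ} 
    (h : ∀ t, ‖ρ t‖ ≤ W) (t : AddCircle (2 * π)) : |ell ε ρ t| ≤ max 0 (log (W / ε)) := by
  rw [abs_of_nonneg (ell_nonneg _ _ _)]
  exact ell_le hε (h t)

lemma step_I {ε K g W η : ℝ} (hε : 0 < ε) (g0 : 0 ≤ g) (g1 : g ≤ 1 / 2)
    {ρ : AddCircle (2 * π) → ℂ} (hm : Measurable ρ) (hρ : ∀ t, ‖ρ t‖ ≤ W)
    {d : AddCircle (2 * π) → ℝ} (hd : Measurable d) (hd1 : ∀ t, |d t| ≤ 1) (hη : 0 < η) :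
    ∀ᶠ M : ℕ in atTop, Iell d ε (nxt ε K g M ρ) ≤ Iell d ε ρ + η := by
  have hU := Uset_measurable ε K hm
  have ha : Measurable (fun t => d t * (Uset ε K ρ).indicator (fun _ => (1 : ℝ)) t) :=
    hd.mul (measurable_const.indicator hU)
  have hind : ∀ t, |(Uset ε K ρ).indicator (fun _ => (1 : ℝ)) t| ≤ 1 := by
    intro t; by_cases ht : t ∈ Uset ε K ρ <;> simp [ht]
  have hab : ∀ t, |d t * (Uset ε K ρ).indicator (fun _ => (1 : ℝ)) t| ≤ 1 := by
    intro t
    rw [abs_mul]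
    exact mul_le_one₀ (hd1 t) (abs_nonneg _) (hind t)
  have h := equidist ha hab (xi_continuous g0 g1)
  rw [xi_integral g0 g1, mul_zero] at h
  filter_upwards [h.eventually (gt_mem_nhds hη)] with M hM
  have e : Iell d ε (nxt ε K g M ρ) = Iell d ε ρ +
      ∫ t, d t * (Uset ε K ρ).indicator (fun _ => (1 : ℝ)) t * xi g ((M : ℤ) • t) := by
    unfold Iell
    rw [← integral_add]
    · refine integral_congr_ae (Eventually.of_forall fun t => ?_)
      simp only [ell_nxt hε g0 g1]
      ring
    · refine rint (γ := 1 * max 0 (log (W / ε))) (hd.mul (ell_measurable ε hm)) fun t => ?_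
      rw [abs_mul]
      exact mul_le_mul (hd1 t) (ell_abs hε hρ t) (abs_nonneg _) zero_le_one
    · obtain ⟨X, hX⟩ := (isCompact_range (xi_continuous g0 g1)).isBounded.exists_norm_le
      refine rint (γ := 1 * X) (ha.mul ((xi_continuous g0 g1).comp
        (continuous_zsmul (M : ℤ))).measurable) fun t => ?_
      rw [abs_mul]
      exact mul_le_mul (hab t) (hX _ ⟨_, rfl⟩) (abs_nonneg _) zero_le_one
  rw [e]
  linarith

lemma int3 {a b c : AddCircle (2 * π) → ℝ} (ha : Integrable a) (hb : Integrable b)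
    (hc : Integrable c) :
    ∫ t, (a t + 2 * b t + c t) = (∫ t, a t) + 2 * (∫ t, b t) + ∫ t, c t := by
  have hab : Integrable (fun t => a t + 2 * b t) := ha.add (hb.const_mul 2)
  rw [integral_add hab hc, integral_add ha (hb.const_mul 2), integral_const_mul]

lemma step_sq {ε K g W η : ℝ} (hε : 0 < ε) (g0 : 0 ≤ g) (g1 : g ≤ 1 / 2)
    {ρ : AddCircle (2 * π) → ℂ} (hm : Measurable ρ) (hρ : ∀ t, ‖ρ t‖ ≤ W) (hη : 0 < η) :
    ∀ᶠ M : ℕ in atTop, (∫ t, ell ε ρ t ^ 2) +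
      (2 * π)⁻¹ * volume.real (Uset ε K ρ) * (∫ y, xi g y ^ 2) - η ≤
        ∫ t, ell ε (nxt ε K g M ρ) t ^ 2 := by
  have hU := Uset_measurable ε K hm
  set u : AddCircle (2 * π) → ℝ := (Uset ε K ρ).indicator (fun _ => (1 : ℝ)) with hu
  set L := max 0 (log (W / ε)) with hL
  have hum : Measurable u := measurable_const.indicator hU
  have hind : ∀ t, |u t| ≤ 1 := by
    intro t; by_cases ht : t ∈ Uset ε K ρ <;> simp [hu, ht]
  have husq : ∀ t, u t ^ 2 = u t := by
    intro t; by_cases ht : t ∈ Uset ε K ρ <;> simp [hu, ht]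
  have ha : Measurable (fun t => ell ε ρ t * u t) := (ell_measurable ε hm).mul hum
  have hab : ∀ t, |ell ε ρ t * u t| ≤ L * 1 := by
    intro t
    rw [abs_mul]
    exact mul_le_mul (ell_abs hε hρ t) (hind t) (abs_nonneg _) (le_max_left _ _)
  have hξ := xi_continuous g0 g1
  obtain ⟨X, hX⟩ := (isCompact_range hξ).isBounded.exists_norm_le
  have hX' : ∀ y, |xi g y| ≤ X := fun y => hX _ ⟨_, rfl⟩
  have h1 := equidist ha hab hξ
  rw [xi_integral g0 g1, mul_zero] at h1
  have h2 := equidist (ψ := fun y => xi g y ^ 2) hum hind (hξ.pow 2)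
  have hiu : ∫ t, u t = volume.real (Uset ε K ρ) := by
    rw [hu, integral_indicator_const _ hU]; simp
  rw [hiu] at h2
  filter_upwards [h1.eventually (lt_mem_nhds (show -(η / 4) < 0 by linarith)),
    h2.eventually (lt_mem_nhds (show _ - η / 2 < _ from sub_lt_self _ (by linarith)))] with M hM1 hM2
  have hξm : Measurable (fun t : AddCircle (2 * π) => xi g ((M : ℤ) • t)) :=
    (hξ.comp (continuous_zsmul (M : ℤ))).measurable
  have i1 : Integrable (fun t => ell ε ρ t ^ 2) := by
    refine rint (γ := L ^ 2) ((ell_measurable ε hm).pow_const 2) fun t => ?_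
    rw [abs_pow]
    exact pow_le_pow_left₀ (abs_nonneg _) (ell_abs hε hρ t) 2
  have i2 : Integrable (fun t => ell ε ρ t * u t * xi g ((M : ℤ) • t)) := by
    refine rint (γ := L * 1 * X) (ha.mul hξm) fun t => ?_
    rw [abs_mul]
    exact mul_le_mul (hab t) (hX' _) (abs_nonneg _) (by positivity)
  have i3 : Integrable (fun t => u t * xi g ((M : ℤ) • t) ^ 2) := by
    refine rint (γ := 1 * X ^ 2) (hum.mul (hξm.pow_const 2)) fun t => ?_
    rw [abs_mul, abs_pow]
    exact mul_le_mul (hind t) (pow_le_pow_left₀ (abs_nonneg _) (hX' _) 2) (by positivity)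
      zero_le_one
  have e : ∫ t, ell ε (nxt ε K g M ρ) t ^ 2 = (∫ t, ell ε ρ t ^ 2) +
      2 * (∫ t, ell ε ρ t * u t * xi g ((M : ℤ) • t)) + ∫ t, u t * xi g ((M : ℤ) • t) ^ 2 := by
    rw [← int3 i1 i2 i3]
    refine integral_congr_ae (Eventually.of_forall fun t => ?_)
    simp only [ell_nxt hε g0 g1]
    rw [← hu]
    have := husq t
    linear_combination (xi g ((M : ℤ) • t)) ^ 2 * this
  rw [e]
  linarith

end Rep


namespace Rep

/-- State of the process. -/
def State (Λ : Set ℤ) (N : ℕ) (f : AddCircle (2 * π) → ℂ) (d : AddCircle (2 * π) → ℝ)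
    (ε W η0 η : ℝ) (ρ : AddCircle (2 * π) → ℂ) (c : ℤ →₀ ℂ) : Prop :=
  Measurable ρ ∧ (∀ t, ‖ρ t‖ ≤ W) ∧ (∀ k ∈ c.support, k ∈ Λ ∧ (N : ℤ) < k) ∧
  SM (fun t => f t - ρ t - T c t) η ∧ Iell d ε ρ ≤ Iell d ε f + η ∧
  Iell (fun _ => 1) ε ρ ≤ Iell (fun _ => 1) ε f + η ∧
  ∀ n, ∃ h : AddCircle (2 * π) → ℂ, Measurable h ∧ (∀ t, ‖h t‖ ≤ W) ∧
    Iell d ε h ≤ Iell d ε f + η ∧ SM (fun t => S n c t - (f t - h t)) (η0 + η)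

lemma process {Λ : Set ℤ} (hBP : BP Λ) {η0 : ℝ} (hη0 : 0 < η0) {ε K W θ : ℝ} (hε : 0 < ε)
    (hK : 0 < K) (hW : 2 * K ≤ W) (hθ : 0 < θ) (N : ℕ) {f : AddCircle (2 * π) → ℂ}
    (hfm : Measurable f) (hf : ∀ t, ‖f t‖ ≤ W) {d : AddCircle (2 * π) → ℝ}
    (hd : Measurable d) (hd1 : ∀ t, |d t| ≤ 1) {η : ℝ} (hη : 0 < η) :
    ∃ ρ c, State Λ N f d ε W η0 η ρ c ∧ volume.real (Uset ε K ρ) ≤ θ := by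
  obtain ⟨γ, hγ, hBP⟩ := hBP η0 hη0
  obtain ⟨g, g0, g1, gK⟩ : ∃ g : ℝ, 0 < g ∧ g ≤ 1 / 2 ∧ g * K ≤ γ := by
    refine ⟨min (1 / 2) (γ / K), by positivity, min_le_left _ _, ?_⟩
    have := min_le_right (1 / 2) (γ / K)
    rwa [le_div_iff₀ hK] at this
  set v := (2 * π)⁻¹ * ∫ y, xi g y ^ 2 with hv
  have hv0 : 0 < v := mul_pos (by positivity) (xi_sq_pos g0 g1)
  have key : ∀ B : ℕ, ∀ η : ℝ, 0 < η → ∃ ρ c, State Λ N f d ε W η0 η ρ c ∧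
      (volume.real (Uset ε K ρ) ≤ θ ∨ B * (v * θ / 2) ≤ ∫ t, ell ε ρ t ^ 2) := by
    intro B
    induction B with
    | zero =>
      intro η hη
      refine ⟨f, 0, ⟨hfm, hf, by simp, ?_, by linarith, by linarith, ?_⟩, Or.inr ?_⟩
      · exact SM.of_bound hη.le (fun t => by simp [T_zero, hη.le])
      · intro n
        refine ⟨f, hfm, hf, by linarith, ?_⟩
        exact SM.of_bound (by linarith) (fun t => by rw [S_zero]; simp; linarith)
      · simp only [CharP.cast_eq_zero, zero_mul]
        exact integral_nonneg (fun t => sq_nonneg _)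
    | succ B ih =>
      intro η hη
      obtain ⟨ρ, c, ⟨h1, h2, h3, h4, h5, h6, h7⟩, h8⟩ := ih (η / 2) (by linarith)
      by_cases hU : volume.real (Uset ε K ρ) ≤ θ
      · refine ⟨ρ, c, ⟨h1, h2, h3, h4.mono (by linarith), by linarith, by linarith, ?_⟩, Or.inl hU⟩
        intro n
        obtain ⟨h, a1, a2, a3, a4⟩ := h7 n
        exact ⟨h, a1, a2, by linarith, a4.mono (by linarith)⟩
      · have h8 := h8.resolve_left hU
        push Not at hU
        obtain ⟨N', hN1, hN2⟩ := exists_bound c N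
        have hfr := hBP (Qf ε K g ρ) (Qf_measurable ε K g h1) (Qf_bound g0.le hγ.le gK ρ)
          (η / 2) (by linarith) N'
        have e1 := step_I (K := K) hε g0.le g1 h1 h2 hd hd1 (η := η / 2) (by linarith)
        have e2 := step_I (K := K) hε g0.le g1 h1 h2 (d := fun _ => 1) measurable_const
          (by simp) (η := η / 2) (by linarith)
        have e3 := step_sq (K := K) hε g0.le g1 h1 h2 (η := v * θ / 2) (by positivity)
        obtain ⟨M, ⟨c1, b1, b2, b3⟩, e1, e2, e3⟩ := (hfr.and_eventually (e1.and (e2.and e3))).exists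
        refine ⟨nxt ε K g M ρ, c + c1, ⟨nxt_measurable ε K g M h1,
          nxt_bound g0.le g1 hW M h2, ?_, ?_, by linarith, by linarith, ?_⟩, Or.inr ?_⟩
        · intro k hk
          classical
          rcases Finset.mem_union.1 (Finsupp.support_add hk) with hk | hk
          · exact h3 k hk
          · obtain ⟨x, y⟩ := b1 k hk
            exact ⟨x, by omega⟩
        · have := h4.sub b2
          rw [add_halves] at this
          refine this.of_le fun t => le_of_eq ?_
          congr 1
          rw [T_add, nxt]
          ring
        · intro n
          rcases le_total n (N' : ℤ) with hn | hn
          · obtain ⟨h, a1, a2, a3, a4⟩ := h7 n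
            refine ⟨h, a1, a2, by linarith, ?_⟩
            refine (a4.mono (show η0 + η / 2 ≤ η0 + η by linarith)).of_le fun t => ?_
            rw [S_concat_le (fun k hk => (b1 k hk).2) hn]
          · refine ⟨ρ, h1, h2, by linarith, ?_⟩
            refine (((b3 n).sub h4).mono (show η0 + η / 2 ≤ η0 + η by linarith)).of_le fun t => ?_
            rw [S_concat_ge hN2 hn]
            refine le_of_eq ?_
            congr 1
            ring
        · have e4 : v * θ ≤ (2 * π)⁻¹ * volume.real (Uset ε K ρ) * ∫ y, xi g y ^ 2 := by
            have : (2 * π)⁻¹ * volume.real (Uset ε K ρ) * (∫ y, xi g y ^ 2) =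
              v * volume.real (Uset ε K ρ) := by rw [hv]; ring
            rw [this]
            gcongr
          push_cast
          linarith
  set L := max 0 (log (W / ε)) with hL
  obtain ⟨B, hB⟩ := exists_nat_gt (2 * π * L ^ 2 / (v * θ / 2))
  obtain ⟨ρ, c, hs, h8⟩ := key B η hη
  refine ⟨ρ, c, hs, h8.resolve_right ?_⟩
  rw [not_le]
  have h1 : ∫ t, ell ε ρ t ^ 2 ≤ L ^ 2 * (volume : Measure (AddCircle (2 * π))).real Set.univ := by
    refine (Real.le_norm_self _).trans ?_
    refine norm_integral_le_of_norm_le_const (Eventually.of_forall fun t => ?_)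
    rw [norm_pow]
    exact pow_le_pow_left₀ (abs_nonneg _) (ell_abs hε hs.2.1 t) 2
  rw [vol_univ] at h1
  rw [div_lt_iff₀ (by positivity)] at hB
  linarith

end Rep


namespace Rep

/-- The compatibility condition between `δ` and `κ`. -/
def Cond (δ κ : ℝ) : Prop :=
  16 * δ ≤ κ ∧ 2 * π * log 16 + 1 ≤ κ / 4 * log (4 * κ / δ)

lemma exists_trunc {f : AddCircle (2 * π) → ℂ} (hf : Measurable f) {δ : ℝ} (hδ : 0 < δ) :
    ∃ A : ℝ, 0 < A ∧ volume.real {t | A < ‖f t‖} ≤ δ := by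
  have h := tendsto_measure_iInter_atTop (μ := (volume : Measure (AddCircle (2 * π))))
    (s := fun n : ℕ => {t | (n : ℝ) < ‖f t‖})
    (fun n => (measurableSet_lt measurable_const hf.norm).nullMeasurableSet)
    (fun m n hmn t (ht : (n : ℝ) < ‖f t‖) =>
      show (m : ℝ) < ‖f t‖ from lt_of_le_of_lt (Nat.cast_le.2 hmn) ht) ⟨0, by finiteness⟩
  have h0 : ⋂ n : ℕ, {t | (n : ℝ) < ‖f t‖} = ∅ := by
    ext t
    simp only [Set.mem_iInter, Set.mem_empty_iff_false, iff_false, not_forall]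
    obtain ⟨n, hn⟩ := exists_nat_ge ‖f t‖
    exact ⟨n, not_lt.mpr hn⟩
  rw [h0, measure_empty] at h
  have h2 := (ENNReal.tendsto_toReal ENNReal.zero_ne_top).comp h
  rw [ENNReal.toReal_zero] at h2
  obtain ⟨n, hn, hn1⟩ := ((h2.eventually (gt_mem_nhds hδ)).and (eventually_ge_atTop 1)).exists
  exact ⟨n, by exact_mod_cast hn1, hn.le⟩

lemma markov {ε W x : ℝ} (hε : 0 < ε) (hx : ε ≤ x) {h : AddCircle (2 * π) → ℂ}
    (hm : Measurable h) (hb : ∀ t, ‖h t‖ ≤ W) {D : Set (AddCircle (2 * π))}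
    (hD : MeasurableSet D) :
    volume.real (D ∩ {t | x < ‖h t‖}) * log (x / ε) ≤ Iell (D.indicator fun _ => 1) ε h := by
  have hE : MeasurableSet (D ∩ {t | x < ‖h t‖}) :=
    hD.inter (measurableSet_lt measurable_const hm.norm)
  have h1 := integral_indicator_const (μ := (volume : Measure (AddCircle (2 * π))))
    (log (x / ε)) hE
  rw [smul_eq_mul] at h1
  rw [← h1]
  unfold Iell
  refine integral_mono ((integrable_const _).indicator hE) ?_ ?_
  · refine rint (γ := 1 * max 0 (log (W / ε)))
      ((measurable_const.indicator hD).mul (ell_measurable ε hm)) fun t => ?_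
    rw [abs_mul]
    refine mul_le_mul ?_ (ell_abs hε hb t) (abs_nonneg _) zero_le_one
    by_cases ht : t ∈ D <;> simp [ht]
  · intro t
    by_cases ht : t ∈ D ∩ {t | x < ‖h t‖}
    · simp only [Set.indicator_of_mem ht, Set.indicator_of_mem ht.1, one_mul]
      refine le_trans ?_ (le_max_right _ _)
      have h3 : x < ‖h t‖ := ht.2
      have hx0 : 0 < x := by linarith
      apply Real.log_le_log (by positivity)
      gcongr
    · simp only [Set.indicator_of_notMem ht]
      refine mul_nonneg ?_ (ell_nonneg _ _ _)
      exact Set.indicator_nonneg (fun _ _ => zero_le_one) _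

lemma lemmaS {Λ : Set ℤ} (hBP : BP Λ) {f : AddCircle (2 * π) → ℂ} (hfm : Measurable f)
    {δ : ℝ} (hδ : 0 < δ) (hSM : SM f δ) (N : ℕ) :
    ∃ c : ℤ →₀ ℂ, (∀ k ∈ c.support, k ∈ Λ ∧ (N : ℤ) < k) ∧
      SM (fun t => f t - T c t) (δ / 2) ∧ ∀ n κ, Cond δ κ → SM (S n c) κ := by
  obtain ⟨A, hA, hAm⟩ := exists_trunc hfm (show 0 < δ / 8 by positivity)
  set f1 : AddCircle (2 * π) → ℂ := {t | ‖f t‖ ≤ A}.indicator f with hf1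
  have hf1m : Measurable f1 := hfm.indicator (measurableSet_le hfm.norm measurable_const)
  have hf1A : ∀ t, ‖f1 t‖ ≤ A := by
    intro t
    by_cases ht : ‖f t‖ ≤ A
    · rw [hf1, Set.indicator_of_mem (show t ∈ {t | ‖f t‖ ≤ A} from ht)]; exact ht
    · rw [hf1, Set.indicator_of_notMem (show t ∉ {t | ‖f t‖ ≤ A} from ht)]; simpa using hA.le
  have hf1f : ∀ t, ‖f1 t‖ ≤ ‖f t‖ := fun t => norm_indicator_le_norm_self _ _
  have hff1 : SM (fun t => f t - f1 t) (δ / 8) := by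
    refine SM.of_set _ hAm fun t ht => ?_
    have ht' : ‖f t‖ ≤ A := not_lt.1 ht
    rw [hf1, Set.indicator_of_mem (show t ∈ {t | ‖f t‖ ≤ A} from ht')]
    simp; positivity
  set ε := δ / 16 with hεd
  have hε : 0 < ε := by positivity
  set D : Set (AddCircle (2 * π)) := {t | ‖f t‖ ≤ δ} with hD
  have hDm : MeasurableSet D := measurableSet_le hfm.norm measurable_const
  set J := Iell (fun _ => 1) ε f1 with hJ
  have hJ0 : 0 ≤ J := integral_nonneg fun t => by
    simpa using ell_nonneg _ _ _
  set K := ε * exp ((J + 1) * (16 / δ)) with hK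
  have hlog : log (K / ε) = (J + 1) * (16 / δ) := by
    rw [hK, mul_div_cancel_left₀ _ hε.ne', Real.log_exp]
  have hKε : ε ≤ K := by
    rw [hK]
    have : 1 ≤ exp ((J + 1) * (16 / δ)) := Real.one_le_exp (by positivity)
    nlinarith
  have hK0 : 0 < K := by linarith
  set W := max A (2 * K) with hW
  set η := min (δ / 16) 1 with hη
  have hη0 : 0 < η := by positivity
  have hη1 : η ≤ δ / 16 := min_le_left _ _
  have hη2 : η ≤ 1 := min_le_right _ _
  obtain ⟨ρ, c, ⟨h1, h2, h3, h4, h5, h6, h7⟩, hU⟩ := process hBP (η0 := δ / 8) (by positivity)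
    hε hK0 (le_max_right A (2 * K)) (θ := δ / 16) (by positivity) N hf1m
    (fun t => (hf1A t).trans (le_max_left _ _))
    (d := D.indicator fun _ => 1) (measurable_const.indicator hDm)
    (fun t => by by_cases ht : t ∈ D <;> simp [ht]) hη0
  refine ⟨c, h3, ?_, ?_⟩
  · have hρ : SM ρ (δ / 8) := by
      refine SM.of_set (Uset ε K ρ ∪ {t | K < ‖ρ t‖}) ?_ ?_
      · refine (measureReal_union_le _ _).trans ?_
        have m := markov hε hKε h1 h2 MeasurableSet.univ
        rw [Set.univ_inter, Set.indicator_univ, hlog] at m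
        have m2 : volume.real {t | K < ‖ρ t‖} * ((J + 1) * (16 / δ)) ≤ J + 1 := by linarith
        have m3 : volume.real {t | K < ‖ρ t‖} ≤ δ / 16 := by
          have : (J + 1) * (volume.real {t | K < ‖ρ t‖} * (16 / δ)) ≤ (J + 1) * 1 := by linarith
          have := le_of_mul_le_mul_left this (by linarith)
          rw [mul_div_assoc', div_le_iff₀ hδ] at this
          linarith
        linarith
      · intro t ht
        simp only [Set.mem_union, not_or] at ht
        have a2 : ‖ρ t‖ ≤ K := not_lt.1 ht.2
        by_contra hh
        exact ht.1 ⟨by rw [hεd]; linarith, a2⟩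
    have := ((hff1.add h4).add hρ).mono (show δ / 8 + η + δ / 8 ≤ δ / 2 by linarith)
    refine this.of_le fun t => le_of_eq ?_
    congr 1
    ring
  · intro n κ ⟨hc1, hc2⟩
    obtain ⟨h, a1, a2, a3, a4⟩ := h7 n
    have hIf : Iell (D.indicator fun _ => 1) ε f1 ≤ 2 * π * log 16 := by
      have : Iell (D.indicator fun _ => 1) ε f1 ≤
          log 16 * (volume : Measure (AddCircle (2 * π))).real Set.univ := by
        unfold Iell
        refine (Real.le_norm_self _).trans ?_
        refine norm_integral_le_of_norm_le_const (Eventually.of_forall fun t => ?_)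
        by_cases ht : t ∈ D
        · rw [Set.indicator_of_mem ht, one_mul]
          have : ‖f1 t‖ ≤ δ := (hf1f t).trans ht
          refine (ell_abs (W := δ) hε (ρ := fun s => f1 t) (fun _ => this) t).trans ?_
          rw [hεd, div_div_cancel₀ hδ.ne']
          exact max_le (Real.log_nonneg (by norm_num)) le_rfl
        · rw [Set.indicator_of_notMem ht]
          simpa using Real.log_nonneg (by norm_num)
      rw [vol_univ] at this
      linarith
    have hκ : 0 < κ := by linarith
    have m := markov hε (x := κ / 4) (by rw [hεd]; linarith) a1 a2 hDm
    have hx : κ / 4 / ε = 4 * κ / δ := by rw [hεd]; field_simp; norm_num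
    rw [hx] at m
    have hlp : 0 < log (4 * κ / δ) := by
      apply Real.log_pos
      rw [lt_div_iff₀ hδ]
      linarith
    have m2 : volume.real (D ∩ {t | κ / 4 < ‖h t‖}) ≤ κ / 4 :=
      le_of_mul_le_mul_right (by linarith) hlp
    have hfh : SM (fun t => f1 t - h t) (κ / 2) := by
      refine SM.of_set ({t | δ < ‖f t‖} ∪ (D ∩ {t | κ / 4 < ‖h t‖})) ?_ ?_
      · refine (measureReal_union_le _ _).trans ?_
        unfold SM at hSM
        linarith
      · intro t ht
        simp only [Set.mem_union, not_or] at ht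
        have b1 : ‖f t‖ ≤ δ := not_lt.1 ht.1
        have b2 : ‖h t‖ ≤ κ / 4 := by
          by_contra hh
          exact ht.2 ⟨b1, not_le.1 hh⟩
        refine (norm_sub_le _ _).trans ?_
        linarith [hf1f t]
    refine ((a4.add hfh).mono (by linarith)).of_le fun t => le_of_eq ?_
    congr 1
    ring

end Rep


namespace Rep

lemma cond_eventually {κ : ℝ} (hκ : 0 < κ) : ∃ i0 : ℕ, ∀ i, i0 ≤ i → Cond (8 / 2 ^ i) κ := by
  have h2 : Tendsto (fun i : ℕ => (2 : ℝ) ^ i) atTop atTop :=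
    tendsto_pow_atTop_atTop_of_one_lt (by norm_num)
  have h3 : Tendsto (fun i : ℕ => κ / 2 * (2 : ℝ) ^ i) atTop atTop :=
    h2.const_mul_atTop (by positivity)
  have h4 : Tendsto (fun i : ℕ => κ / 4 * log (κ / 2 * (2 : ℝ) ^ i)) atTop atTop :=
    (Real.tendsto_log_atTop.comp h3).const_mul_atTop (by positivity)
  have h5 := (h2.eventually_ge_atTop (128 / κ)).and
    (h4.eventually_ge_atTop (2 * π * log 16 + 1))
  obtain ⟨i0, hi0⟩ := eventually_atTop.1 h5
  refine ⟨i0, fun i hi => ?_⟩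
  obtain ⟨a, b⟩ := hi0 i hi
  refine ⟨?_, ?_⟩
  · rw [div_le_iff₀ hκ] at a
    rw [mul_div_assoc', div_le_iff₀ (by positivity)]
    linarith
  · have : 4 * κ / (8 / 2 ^ i) = κ / 2 * 2 ^ i := by
      field_simp; norm_num
    rw [this]
    exact b

/-- Link between consecutive polynomials. -/
def Link (i : ℕ) (C C' : ℤ →₀ ℂ) : Prop :=
  ∃ (c : ℤ →₀ ℂ) (N : ℕ), C' = C + c ∧ i ≤ N ∧ (∀ k ∈ C.support, k ≤ (N : ℤ)) ∧
    (∀ k ∈ c.support, (N : ℤ) < k) ∧ ∀ n κ, Cond (8 / 2 ^ i) κ → SM (S n c) κ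

lemma exists_seq {Λ : Set ℤ} (hBP : BP Λ) {f : AddCircle (2 * π) → ℂ} (hfm : Measurable f) :
    ∃ C : ℕ → ℤ →₀ ℂ, (∀ i, ∀ k ∈ (C i).support, k ∈ Λ) ∧
      (∀ i, SM (fun t => f t - T (C i) t) (8 / 2 ^ i)) ∧ ∀ i, Link i (C i) (C (i + 1)) := by
  let P : ℕ → (ℤ →₀ ℂ) → Prop := fun i C =>
    (∀ k ∈ C.support, k ∈ Λ) ∧ SM (fun t => f t - T C t) (8 / 2 ^ i)
  have step : ∀ i C, P i C → ∃ C', P (i + 1) C' ∧ Link i C C' := by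
    intro i C ⟨h1, h2⟩
    obtain ⟨N, hN1, hN2⟩ := exists_bound C i
    obtain ⟨c, c1, c2, c3⟩ := lemmaS hBP (hfm.sub (T_measurable C)) (by positivity) h2 N
    refine ⟨C + c, ⟨?_, ?_⟩, c, N, rfl, hN1, hN2, fun k hk => (c1 k hk).2, c3⟩
    · intro k hk
      classical
      rcases Finset.mem_union.1 (Finsupp.support_add hk) with hk | hk
      · exact h1 k hk
      · exact (c1 k hk).1
    · have e : (8 : ℝ) / 2 ^ (i + 1) = 8 / 2 ^ i / 2 := by rw [pow_succ]; field_simp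
      rw [e]
      refine c2.of_le fun t => le_of_eq ?_
      rw [T_add]
      congr 1
      simp only [Pi.sub_apply]
      ring
  choose! nx hnx using step
  have h0 : P 0 0 := by
    refine ⟨by simp, ?_⟩
    unfold SM
    refine (measureReal_mono (Set.subset_univ _)).trans ?_
    rw [vol_univ]
    have := Real.pi_le_four
    norm_num
    linarith
  let C : ℕ → ℤ →₀ ℂ := fun i => Nat.rec 0 (fun i C => nx i C) i
  have hC : ∀ i, P i (C i) := by
    intro i
    induction i with
    | zero => exact h0
    | succ i ih => exact (hnx i (C i) ih).1
  exact ⟨C, fun i => (hC i).1, fun i => (hC i).2, fun i => (hnx i (C i) (hC i)).2⟩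

lemma S_eq_Icc {n : ℤ} {c : ℤ →₀ ℂ} (h : ∀ k ∈ c.support, 0 < k) (t : AddCircle (2 * π)) :
    S n c t = ∑ k ∈ Finset.Icc 1 n, c k * fourier k t := by
  unfold S T
  rw [Finsupp.sum_of_support_subset (s := Finset.Icc 1 n)]
  · refine Finset.sum_congr rfl fun k hk => ?_
    rw [Finsupp.filter_apply_pos (fun x => x ≤ n) _ (Finset.mem_Icc.1 hk).2]
  · intro k hk
    rw [Finsupp.support_filter, Finset.mem_filter] at hk
    have := h k hk.1
    exact Finset.mem_Icc.2 ⟨by omega, hk.2⟩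
  · simp

lemma main3 {Λ : Set ℤ} (hΛ : ∀ k ∈ Λ, 0 < k) (hBP : BP Λ) {f : AddCircle (2 * π) → ℂ}
    (hfm : Measurable f) :
    ∃ c : ℤ → ℂ, (∀ k, c k ≠ 0 → k ∈ Λ) ∧ ∀ κ : ℝ, 0 < κ → ∃ n0 : ℕ, ∀ n : ℕ, n0 ≤ n →
      SM (fun t => (∑ k ∈ Finset.Icc (1 : ℤ) (n : ℤ), c k * fourier k t) - f t) κ := by
  obtain ⟨C, hC1, hC2, hC3⟩ := exists_seq hBP hfm
  have hstab : ∀ (k : ℤ) (i j : ℕ), k ≤ i → i ≤ j → C j k = C i k := by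
    intro k i j hk hij
    induction j, hij using Nat.le_induction with
    | base => rfl
    | succ j hj ih =>
      obtain ⟨c, N, e, hN, -, hc, -⟩ := hC3 j
      rw [e, Finsupp.add_apply, ih]
      have : c k = 0 := by
        by_contra h
        have := hc k (by simpa using h)
        omega
      rw [this, add_zero]
  refine ⟨fun k => C k.toNat k, fun k hk => hC1 _ k (by simpa using hk), fun κ hκ => ?_⟩
  obtain ⟨i0, hi0⟩ := cond_eventually (show 0 < κ / 2 by positivity)
  obtain ⟨n0, -, hn0⟩ := exists_bound (C i0) 0
  have hδ : ∀ i, i0 ≤ i → (8 : ℝ) / 2 ^ i ≤ κ / 2 := by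
    intro i hi
    have := (hi0 i hi).1
    have h0 : (0 : ℝ) < 8 / 2 ^ i := by positivity
    linarith
  have key : ∀ i, i0 ≤ i → ∀ n : ℤ, n0 ≤ n → SM (fun t => S n (C i) t - f t) κ := by
    intro i hi
    induction i, hi using Nat.le_induction with
    | base =>
      intro n hn
      refine ((hC2 i0).mono ((hδ i0 le_rfl).trans (by linarith))).of_le fun t => le_of_eq ?_
      rw [S_eq_T (fun k hk => (hn0 k hk).trans hn), norm_sub_rev]
    | succ i hi ih =>
      intro n hn
      obtain ⟨c, N, e, hN, h1, h2, h3⟩ := hC3 i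
      rw [e]
      rcases le_total n N with hnN | hnN
      · refine (ih n hn).of_le fun t => le_of_eq ?_
        rw [S_concat_le h2 hnN]
      · have := (h3 n (κ / 2) (hi0 i hi)).sub ((hC2 i).mono (hδ i hi))
        rw [add_halves] at this
        refine this.of_le fun t => le_of_eq ?_
        rw [S_concat_ge h1 hnN]
        congr 1
        ring
  refine ⟨n0, fun n hn => ?_⟩
  refine (key (max i0 n) (le_max_left _ _) n (by exact_mod_cast hn)).of_le fun t => le_of_eq ?_
  rw [S_eq_Icc (fun k hk => hΛ k (hC1 _ k hk))]
  congr 2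
  refine Finset.sum_congr rfl fun k hk => ?_
  rw [hstab k k.toNat (max i0 n) (by omega)]
  have := (Finset.mem_Icc.1 hk).2
  have h2 := le_max_right i0 n
  omega

end Rep


namespace Rep

noncomputable def G (g : ℤ → ℂ) (n : ℤ) (t : AddCircle (2 * π)) : ℂ :=
  ∑ k ∈ Finset.Icc (1 : ℤ) n, g k * fourier k t

noncomputable def D (g : ℤ → ℂ) (n A B : ℤ) (z : ℂ) : ℤ →₀ ℂ :=
  ∑ l ∈ Finset.Icc (1 : ℤ) n, Finsupp.single (A + B * l) (z * g l)

lemma T_D (g : ℤ → ℂ) (n A B : ℤ) (z : ℂ) (t : AddCircle (2 * π)) :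
    T (D g n A B z) t = z * fourier A t * G g n (B • t) := by
  unfold D G
  rw [T_finset_sum, Finset.mul_sum]
  refine Finset.sum_congr rfl fun l _ => ?_
  rw [T_single, fourier_zsmul', fourier_add, mul_comm l B]
  ring

lemma S_finset_sum {ι : Type*} (n : ℤ) (s : Finset ι) (c : ι → ℤ →₀ ℂ) (t : AddCircle (2 * π)) :
    S n (∑ i ∈ s, c i) t = ∑ i ∈ s, S n (c i) t := by
  classical
  induction s using Finset.induction_on with
  | empty => simp [S_zero]
  | insert i s hi ih => rw [Finset.sum_insert hi, Finset.sum_insert hi, S_add, ih]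

lemma S_D (g : ℤ → ℂ) (n A B : ℤ) (hB : 0 < B) (z : ℂ) (N : ℤ) (t : AddCircle (2 * π)) :
    S N (D g n A B z) t = T (D g (min n ((N - A) / B)) A B z) t := by
  unfold D
  rw [S_finset_sum, T_finset_sum]
  have : Finset.Icc (1 : ℤ) (min n ((N - A) / B)) =
      (Finset.Icc (1 : ℤ) n).filter (fun l => A + B * l ≤ N) := by
    ext l
    simp only [Finset.mem_Icc, Finset.mem_filter, le_min_iff, Int.le_ediv_iff_mul_le hB]
    constructor
    · rintro ⟨h1, h2, h3⟩
      exact ⟨⟨h1, h2⟩, by linarith⟩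
    · rintro ⟨⟨h1, h2⟩, h3⟩
      exact ⟨h1, h2, by linarith⟩
  rw [this, Finset.sum_filter]
  refine Finset.sum_congr rfl fun l _ => ?_
  rw [S_single, T_single]

lemma supp_D {g : ℤ → ℂ} {n A B : ℤ} {z : ℂ} {k : ℤ} (hk : k ∈ (D g n A B z).support) :
    ∃ l : ℤ, 1 ≤ l ∧ l ≤ n ∧ k = A + B * l := by
  classical
  unfold D at hk
  have := Finsupp.support_finsetSum hk
  simp only [Finset.mem_biUnion, Finset.mem_Icc] at this
  obtain ⟨l, hl, h⟩ := this
  have := Finsupp.support_single_subset h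
  exact ⟨l, hl.1, hl.2, by simpa using this⟩

lemma G_measurable (g : ℤ → ℂ) (n : ℤ) : Measurable (G g n) := by
  unfold G
  have : Continuous fun t : AddCircle (2 * π) =>
      ∑ k ∈ Finset.Icc (1 : ℤ) n, g k * (fourier k t : ℂ) := by fun_prop
  exact this.measurable

lemma vol_comp {h : AddCircle (2 * π) → ℂ} (hm : Measurable h) {B : ℤ} (hB : B ≠ 0) (K : ℝ) :
    volume.real {t : AddCircle (2 * π) | K < ‖h (B • t)‖} = volume.real {t | K < ‖h t‖} := by
  have hs : MeasurableSet {t | K < ‖h t‖} := measurableSet_lt measurable_const hm.norm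
  have := (MeasureTheory.Measure.measurePreserving_zsmul (volume : Measure (AddCircle (2 * π))) hB).measureReal_preimage
    hs.nullMeasurableSet
  exact this

lemma SM_comp {h : AddCircle (2 * π) → ℂ} (hm : Measurable h) {B : ℤ} (hB : B ≠ 0) {η : ℝ}
    (hh : SM h η) : SM (fun t => h (B • t)) η := by
  unfold SM
  rw [vol_comp hm hB]
  exact hh

lemma G_bdd {g : ℤ → ℂ} (hg : ∀ κ : ℝ, 0 < κ → ∃ n0 : ℕ, ∀ n : ℕ, n0 ≤ n →
    SM (fun t => G g n t - 1) κ) {ε : ℝ} (hε : 0 < ε) :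
    ∃ K : ℝ, 0 < K ∧ ∀ n : ℤ, volume.real {t | K < ‖G g n t‖} ≤ ε := by
  obtain ⟨n0, hn0⟩ := hg (min ε 1) (by positivity)
  have hpos : 0 ≤ ∑ l ∈ Finset.Icc (1 : ℤ) n0, ‖g l‖ := Finset.sum_nonneg fun _ _ => norm_nonneg _
  refine ⟨2 + ∑ l ∈ Finset.Icc (1 : ℤ) n0, ‖g l‖, by positivity, fun n => ?_⟩
  rcases le_total n n0 with h | h
  · have : {t | 2 + ∑ l ∈ Finset.Icc (1 : ℤ) n0, ‖g l‖ < ‖G g n t‖} = ∅ := by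
      rw [Set.eq_empty_iff_forall_notMem]
      intro t ht
      refine absurd (show 2 + ∑ l ∈ Finset.Icc (1 : ℤ) n0, ‖g l‖ < ‖G g n t‖ from ht) (not_lt.2 ?_)
      have h1 : ‖G g n t‖ ≤ ∑ l ∈ Finset.Icc (1 : ℤ) n, ‖g l‖ := by
        refine (norm_sum_le _ _).trans (Finset.sum_le_sum fun l _ => ?_)
        rw [norm_mul, norm_fourier, mul_one]
      have h2 : ∑ l ∈ Finset.Icc (1 : ℤ) n, ‖g l‖ ≤ ∑ l ∈ Finset.Icc (1 : ℤ) n0, ‖g l‖ :=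
        Finset.sum_le_sum_of_subset_of_nonneg (Finset.Icc_subset_Icc_right h)
          fun _ _ _ => norm_nonneg _
      linarith
    rw [this]
    simpa using hε.le
  · obtain ⟨n', rfl⟩ : ∃ n' : ℕ, n = n' := ⟨n.toNat, by omega⟩
    have h1 := hn0 n' (by exact_mod_cast h)
    refine (measureReal_mono ?_).trans (h1.trans (min_le_left _ _))
    intro t ht
    have ht' : 2 + ∑ l ∈ Finset.Icc (1 : ℤ) n0, ‖g l‖ < ‖G g n' t‖ := ht
    show min ε 1 < ‖G g n' t - 1‖
    have h2 := norm_sub_norm_le (G g n' t) 1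
    rw [norm_one] at h2
    have := min_le_right ε 1
    linarith

end Rep


namespace Rep

lemma sq_filter_le (q : ℤ →₀ ℂ) (p : ℤ → Prop) [DecidablePred p] :
    ∑ k ∈ (q.filter p).support, ‖(q.filter p) k‖ ^ 2 ≤ ∑ k ∈ q.support, ‖q k‖ ^ 2 := by
  rw [Finsupp.support_filter]
  calc ∑ k ∈ q.support with p k, ‖(q.filter p) k‖ ^ 2
      = ∑ k ∈ q.support with p k, ‖q k‖ ^ 2 := by
        refine Finset.sum_congr rfl fun k hk => ?_
        rw [Finsupp.filter_apply_pos _ _ (Finset.mem_filter.1 hk).2]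
    _ ≤ _ := Finset.sum_le_sum_of_subset_of_nonneg (Finset.filter_subset _ _)
        fun _ _ _ => by positivity

lemma exists_enum (s : Finset ℤ) : ∃ (U : ℕ) (e : ℕ → ℤ), (∀ u < U, ∀ v < U, e u = e v → u = v) ∧
    (∀ k ∈ s, ∃ u < U, e u = k) ∧ (∀ u < U, e u ∈ s) := by
  refine ⟨s.toList.length, fun u => s.toList.getD u 0, ?_, ?_, ?_⟩
  · intro u hu v hv h
    simp only [List.getD_eq_getElem _ _ hu, List.getD_eq_getElem _ _ hv] at h
    exact (List.Nodup.getElem_inj_iff s.nodup_toList).1 h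
  · intro k hk
    obtain ⟨u, hu, h⟩ := List.getElem_of_mem (Finset.mem_toList.2 hk)
    exact ⟨u, hu, by simp only [List.getD_eq_getElem _ _ hu]; exact h⟩
  · intro u hu
    simp only [List.getD_eq_getElem _ _ hu]
    exact Finset.mem_toList.1 (List.getElem_mem hu)

lemma SM_scale {h : AddCircle (2 * π) → ℂ} {η : ℝ} (hh : SM h η) {z : ℂ} (hz : ‖z‖ ≤ 1) (k : ℤ) :
    SM (fun t => z * fourier k t * h t) η := by
  refine hh.of_le fun t => ?_
  rw [norm_mul, norm_mul, norm_fourier, mul_one]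
  exact mul_le_of_le_one_left (norm_nonneg _) hz

/-- The square-like condition implies the building block property. -/
lemma BP_of_star {Λ : Set ℤ}
    (hs : ∀ (σ : ℕ → ℤ) (J N : ℕ), ∃ m : ℕ, N < m ∧ ∀ j : ℕ, 1 ≤ j → j ≤ J →
      (m : ℤ) ^ 2 + 2 * m * j + σ j ∈ Λ) : BP Λ := by
  classical
  obtain ⟨g, -, hg⟩ := main3 (Λ := {k : ℤ | 0 < k}) (f := fun _ => (1 : ℂ)) (fun k hk => hk) BP_pos
    measurable_const
  change ∀ κ : ℝ, 0 < κ → ∃ n0 : ℕ, ∀ n : ℕ, n0 ≤ n → SM (fun t => G g n t - 1) κ at hg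
  intro η hη
  obtain ⟨K, hK0, hK⟩ := G_bdd hg (ε := η / 4) (by positivity)
  obtain ⟨γ0, hγ0, hγ1, hγ2⟩ := exists_gamma (η := η / 4) (by positivity)
  set γ := min γ0 (η / 4 / K) with hγdef
  have hγ : 0 < γ := by positivity
  have hγK : γ * K ≤ η / 4 := by
    have : γ ≤ η / 4 / K := min_le_right _ _
    exact (le_div_iff₀ hK0).1 this
  have hγle : γ ≤ γ0 := min_le_left _ _
  have hγone : γ ≤ 1 := hγle.trans hγ1
  have hγsq : γ ^ 2 ≤ (η / 4) ^ 3 / (2 * π) := (by gcongr : γ ^ 2 ≤ γ0 ^ 2).trans hγ2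
  refine ⟨γ, hγ, fun Q hQm hQb η' hη' N => ?_⟩
  obtain ⟨q, hq2, hqQ⟩ := exists_poly hQm hQb (η := η' / 2) (by positivity)
  obtain ⟨U, e, he1, he2, he3⟩ := exists_enum q.support
  have hqn : ∀ k, ‖q k‖ ≤ γ := by
    intro k
    by_cases hk : k ∈ q.support
    · have : ‖q k‖ ^ 2 ≤ ∑ k ∈ q.support, ‖q k‖ ^ 2 :=
        Finset.single_le_sum (f := fun k => ‖q k‖ ^ 2) (fun _ _ => by positivity) hk
      exact le_of_sq_le_sq (this.trans hq2) hγ.le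
    · rw [Finsupp.notMem_support_iff.1 hk, norm_zero]; exact hγ.le
  set τ := min (η' / 2) (η / 4) / (U + 1) with hτdef
  have hτ : 0 < τ := by positivity
  have hUτ : ∀ u : ℕ, u ≤ U → u * τ ≤ min (η' / 2) (η / 4) := by
    intro u hu
    have h1 : (U + 1) * τ = min (η' / 2) (η / 4) := by rw [hτdef]; field_simp
    rw [← h1]
    have : (u : ℝ) ≤ U := by exact_mod_cast hu
    gcongr
    linarith
  obtain ⟨n0, hn0⟩ := hg τ hτ
  set n := max n0 1 with hn
  have hn1 : 1 ≤ n := le_max_right _ _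
  have hGn := hn0 n (le_max_left _ _)
  obtain ⟨R, -, hR⟩ : ∃ R : ℕ, 0 ≤ R ∧ ∀ u < U, |e u| ≤ R := by
    refine ⟨∑ u ∈ Finset.range U, (e u).natAbs, Nat.zero_le _, fun u hu => ?_⟩
    have : (e u).natAbs ≤ ∑ u ∈ Finset.range U, (e u).natAbs :=
      Finset.single_le_sum (f := fun u => (e u).natAbs) (fun _ _ => Nat.zero_le _)
        (Finset.mem_range.2 hu)
    rw [Int.abs_eq_natAbs]
    exact_mod_cast this
  rw [Filter.frequently_atTop]
  intro a
  obtain ⟨m, hm, hmem⟩ := hs (fun j => e (Nat.log (n + 1) j)) ((n + 1) ^ U * n) (a + N + R)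
  have hm0 : 0 < m := by omega
  have hm2 : (m : ℤ) ≤ (m : ℤ) ^ 2 := by
    have : (1 : ℤ) ≤ m := by exact_mod_cast hm0
    nlinarith
  -- blocks
  let B : ℕ → ℤ := fun u => 2 * m * ((n : ℤ) + 1) ^ u
  have hB : ∀ u, 2 * (m : ℤ) ≤ B u := by
    intro u
    have : (1 : ℤ) ≤ ((n : ℤ) + 1) ^ u := one_le_pow₀ (by omega)
    have h0 : (0 : ℤ) ≤ 2 * m := by positivity
    show 2 * (m : ℤ) ≤ 2 * m * ((n : ℤ) + 1) ^ u
    nlinarith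
  have hBpos : ∀ u, 0 < B u := fun u => lt_of_lt_of_le (by positivity) (hB u)
  have hBB : ∀ v u, v < u → B v * (n + 1) ≤ B u := by
    intro v u hvu
    show 2 * (m : ℤ) * ((n : ℤ) + 1) ^ v * (n + 1) ≤ 2 * m * ((n : ℤ) + 1) ^ u
    rw [mul_assoc, ← pow_succ]
    have : ((n : ℤ) + 1) ^ (v + 1) ≤ ((n : ℤ) + 1) ^ u := pow_le_pow_right₀ (by omega) hvu
    have h0 : (0 : ℤ) ≤ 2 * m := by positivity
    exact mul_le_mul_of_nonneg_left this h0
  let d : ℕ → ℤ →₀ ℂ := fun u => D g n ((m : ℤ) ^ 2 + e u) (B u) (q (e u))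
  let c : ℕ → ℤ →₀ ℂ := fun u => ∑ v ∈ Finset.range u, d v
  have hcs : ∀ u, c (u + 1) = c u + d u := fun u => Finset.sum_range_succ _ _
  have hc0 : c 0 = 0 := Finset.sum_range_zero _
  have hsuppc : ∀ u, ∀ k ∈ (c u).support, ∃ v < u, ∃ l : ℤ, 1 ≤ l ∧ l ≤ n ∧
      k = (m : ℤ) ^ 2 + e v + B v * l := by
    intro u k hk
    have := Finsupp.support_finsetSum hk
    simp only [Finset.mem_biUnion, Finset.mem_range] at this
    obtain ⟨v, hv, h⟩ := this
    exact ⟨v, hv, supp_D h⟩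
  let q' : ℕ → ℤ →₀ ℂ := fun u => q.filter (fun k => ∃ v < u, e v = k)
  have hq's : ∀ u < U, q' (u + 1) = q' u + Finsupp.single (e u) (q (e u)) := by
    intro u hu
    ext k
    simp only [q', Finsupp.add_apply, Finsupp.filter_apply, Finsupp.single_apply]
    by_cases hk : e u = k
    · have h1 : ∃ v < u + 1, e v = k := ⟨u, by omega, hk⟩
      have h2 : ¬ ∃ v < u, e v = k := by
        rintro ⟨v, hv, h⟩
        have := he1 v (by omega) u hu (h.trans hk.symm)
        omega
      rw [if_pos h1, if_neg h2, if_pos hk, zero_add, hk]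
    · rw [if_neg hk, add_zero]
      refine if_congr ⟨?_, ?_⟩ rfl rfl
      · rintro ⟨v, hv, h⟩
        refine ⟨v, ?_, h⟩
        rcases Nat.lt_succ_iff_lt_or_eq.1 hv with h' | h'
        · exact h'
        · subst h'; exact absurd h hk
      · rintro ⟨v, hv, h⟩
        exact ⟨v, by omega, h⟩
  have hq'0 : q' 0 = 0 := by
    ext k
    simp [q', Finsupp.filter_apply]
  have hq'U : q' U = q := by
    refine (Finsupp.filter_eq_self_iff _ _).2 fun k hk => ?_
    exact he2 k (by simpa using hk)
  have happ : ∀ u ≤ U, SM (fun t => T (c u) t - fourier ((m : ℤ) ^ 2) t * T (q' u) t) (u * τ) := by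
    intro u
    induction u with
    | zero =>
      intro _
      refine (SM.zero (η := (0 : ℕ) * τ) (by simp)).of_le fun t => ?_
      rw [hc0, hq'0, T_zero]
      simp
    | succ u ih =>
      intro hu
      have h1 := (ih (by omega)).add (SM_scale (SM_comp ((G_measurable g n).sub measurable_const)
        (hBpos u).ne' hGn) ((hqn (e u)).trans hγone) ((m : ℤ) ^ 2 + e u))
      rw [show (u : ℝ) * τ + τ = ((u + 1 : ℕ) : ℝ) * τ by push_cast; ring] at h1
      refine h1.of_le fun t => le_of_eq ?_
      rw [hcs, hq's u (by omega), T_add, T_add, T_single, T_D]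
      simp only [Pi.sub_apply]
      rw [fourier_add]
      congr 1
      ring
  have hTc : ∀ u ≤ U, SM (T (c u)) (η / 2) := by
    intro u hu
    have h1 : SM (T (q' u)) (η / 4) :=
      SM_of_sq (by positivity) (((sq_filter_le q _).trans hq2).trans hγsq)
    have h2 := ((happ u hu).mono ((hUτ u hu).trans (min_le_right _ _))).tri h1
      (f := T (c u)) (fun t => by
        have := norm_add_le (T (c u) t - fourier ((m : ℤ) ^ 2) t * T (q' u) t)
          (fourier ((m : ℤ) ^ 2) t * T (q' u) t)
        rw [sub_add_cancel, norm_mul (fourier ((m : ℤ) ^ 2) t), norm_fourier, one_mul] at this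
        exact this)
    exact h2.mono (by linarith)
  have hSd : ∀ u N, SM (S N (d u)) (η / 4) := by
    intro u N
    refine SM.of_set {t | K < ‖G g (min (n : ℤ) ((N - ((m : ℤ) ^ 2 + e u)) / B u)) (B u • t)‖} ?_ ?_
    · rw [vol_comp (G_measurable _ _) (hBpos u).ne']
      exact hK _
    · intro t ht
      have ht' := not_lt.1 (show ¬ (K < _) from ht)
      rw [S_D _ _ _ _ (hBpos u), T_D, norm_mul, norm_mul, norm_fourier, mul_one]
      refine le_trans ?_ hγK
      exact mul_le_mul (hqn _) ht' (norm_nonneg _) hγ.le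
  have hS : ∀ u ≤ U, ∀ N, SM (S N (c u)) η := by
    intro u
    induction u with
    | zero =>
      intro _ N
      refine (SM.zero hη.le).of_le fun t => ?_
      rw [hc0, S_zero]
    | succ u ih =>
      intro hu N
      have hc : ∀ k ∈ (c u).support, k ≤ (m : ℤ) ^ 2 + e u + B u - 1 := by
        intro k hk
        obtain ⟨v, hv, l, hl1, hl2, rfl⟩ := hsuppc u k hk
        have h1 := hBB v u hv
        have h2 : B v * l ≤ B v * n := mul_le_mul_of_nonneg_left hl2 (hBpos v).le
        have h3 := abs_le.1 (hR v (by omega))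
        have h4 := abs_le.1 (hR u (by omega))
        have h5 := hB v
        rw [mul_add, mul_one] at h1
        have h6 : (R : ℤ) < m := by exact_mod_cast (by omega : R < m)
        linarith
      have hd : ∀ k ∈ (d u).support, (m : ℤ) ^ 2 + e u + B u - 1 < k := by
        intro k hk
        obtain ⟨l, hl1, hl2, rfl⟩ := supp_D hk
        have h2 : B u * 1 ≤ B u * l := mul_le_mul_of_nonneg_left hl1 (hBpos u).le
        linarith
      rw [hcs]
      rcases le_total N ((m : ℤ) ^ 2 + e u + B u - 1) with h | h
      · refine (ih (by omega) N).of_le fun t => le_of_eq ?_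
        rw [S_concat_le hd h]
      · refine (((hTc u (by omega)).add (hSd u N)).mono (by linarith)).of_le fun t => le_of_eq ?_
        rw [S_concat_ge hc h]
  refine ⟨m ^ 2, ?_, c U, ?_, ?_, hS U le_rfl⟩
  · have : m ≤ m ^ 2 := by exact_mod_cast hm2
    omega
  · intro k hk
    obtain ⟨u, hu, l, hl1, hl2, rfl⟩ := hsuppc U k hk
    obtain ⟨l, rfl⟩ : ∃ l' : ℕ, l = l' := ⟨l.toNat, by omega⟩
    have hl1 : 1 ≤ l := by exact_mod_cast hl1
    have hl2 : l ≤ n := by exact_mod_cast hl2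
    constructor
    · have hpu : 1 ≤ (n + 1) ^ u := Nat.one_le_pow _ _ (by omega)
      have h1 := hmem ((n + 1) ^ u * l) (Nat.mul_pos hpu hl1)
        (Nat.mul_le_mul (Nat.pow_le_pow_right (by omega) hu.le) hl2)
      have h2 : Nat.log (n + 1) ((n + 1) ^ u * l) = u := by
        refine Nat.log_eq_of_pow_le_of_lt_pow ?_ ?_
        · exact Nat.le_mul_of_pos_right _ hl1
        · rw [pow_succ]
          exact Nat.mul_lt_mul_of_pos_left (by omega) hpu
      rw [h2] at h1
      convert h1 using 1
      show (m : ℤ) ^ 2 + e u + 2 * m * ((n : ℤ) + 1) ^ u * l = _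
      push_cast
      ring
    · have h3 := abs_le.1 (hR u hu)
      have h5 := hB u
      have h6 : (R : ℤ) < m := by exact_mod_cast (by omega : R < m)
      have h7 : (N : ℤ) < m := by exact_mod_cast (by omega : N < m)
      have h2 : B u * 1 ≤ B u * l :=
        mul_le_mul_of_nonneg_left (by exact_mod_cast hl1) (hBpos u).le
      linarith
  · have h1 := ((happ U le_rfl).mono ((hUτ U le_rfl).trans (min_le_left _ _))).tri hqQ
      (f := fun t => T (c U) t - fourier ((m ^ 2 : ℕ) : ℤ) t * Q t) (fun t => by
        rw [hq'U]
        have := norm_add_le (T (c U) t - fourier ((m : ℤ) ^ 2) t * T q t)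
          (fourier ((m : ℤ) ^ 2) t * (T q t - Q t))
        rw [norm_mul (fourier ((m : ℤ) ^ 2) t), norm_fourier, one_mul] at this
        refine le_trans (le_of_eq ?_) this
        push_cast
        congr 1
        ring)
    rwa [add_halves] at h1

end Rep


namespace Rep

/-- The desired perturbation at `k`. -/
noncomputable def rr (k : ℕ) : ℤ :=
  ((Encodable.decode (α := List ℤ) (Nat.log 2 k).unpair.1).getD []).getD (k - 2 ^ Nat.log 2 k) 0 -
    ((k - 2 ^ Nat.log 2 k : ℕ) : ℤ) ^ 2

open Classical in
/-- The perturbed squares. -/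
noncomputable def aa (w : ℕ → ℝ) (k : ℕ) : ℤ :=
  if ((rr k : ℤ) : ℝ) ^ 2 ≤ w k ∧ 0 < (k : ℤ) ^ 2 + rr k then (k : ℤ) ^ 2 + rr k else (k : ℤ) ^ 2

lemma aa_pos (w : ℕ → ℝ) {k : ℕ} (hk : 1 ≤ k) : 0 < aa w k := by
  unfold aa
  split_ifs with h
  · exact h.2
  · positivity

lemma aa_sq (w : ℕ → ℝ) (hw : ∀ k, 0 < w k) (k : ℕ) : ((aa w k : ℝ) - (k : ℝ) ^ 2) ^ 2 ≤ w k := by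
  unfold aa
  split_ifs with h
  · refine le_trans (le_of_eq ?_) h.1
    push_cast
    ring
  · push_cast
    simpa using (hw k).le

lemma aa_tendsto (w : ℕ → ℝ) (hwpos : ∀ k, 0 < w k) (hw : Tendsto w atTop atTop) :
    Tendsto (fun k => |(aa w k : ℝ) - (k : ℝ) ^ 2| / w k) atTop (𝓝 0) := by
  have h1 : Tendsto (fun k => (√(w k))⁻¹) atTop (𝓝 0) :=
    tendsto_inv_atTop_zero.comp (tendsto_sqrt_atTop.comp hw)
  refine squeeze_zero (fun k => div_nonneg (abs_nonneg _) (hwpos k).le) (fun k => ?_) h1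
  have h2 : |(aa w k : ℝ) - (k : ℝ) ^ 2| ≤ √(w k) := Real.abs_le_sqrt (aa_sq w hwpos k)
  have h3 : 0 < √(w k) := Real.sqrt_pos.2 (hwpos k)
  rw [div_le_iff₀ (hwpos k)]
  refine h2.trans (le_of_eq ?_)
  nth_rewrite 3 [← Real.mul_self_sqrt (hwpos k).le]
  field_simp

lemma aa_star (w : ℕ → ℝ) (hw : Tendsto w atTop atTop) (σ : ℕ → ℤ) (J N : ℕ) :
    ∃ m : ℕ, N < m ∧ ∀ j : ℕ, 1 ≤ j → j ≤ J →
      (m : ℤ) ^ 2 + 2 * m * j + σ j ∈ aa w '' {k : ℕ | 1 ≤ k} := by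
  set lst : List ℤ := (List.range (J + 1)).map σ with hlst
  set X : ℕ := ∑ j ∈ Finset.range (J + 1), (σ j - (j : ℤ) ^ 2).natAbs with hX
  obtain ⟨k0, hk0⟩ := Filter.eventually_atTop.1 (hw.eventually_ge_atTop ((X : ℝ) ^ 2))
  set i := N + J + X + k0 with hi
  set n := Nat.pair (Encodable.encode lst) i with hn
  have hin : i ≤ n := Nat.right_le_pair _ _
  have hnm : n < 2 ^ n := Nat.lt_two_pow_self
  refine ⟨2 ^ n, by omega, fun j hj1 hj2 => ?_⟩
  have hlog : Nat.log 2 (2 ^ n + j) = n := by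
    refine Nat.log_eq_of_pow_le_of_lt_pow (by omega) ?_
    rw [pow_succ]; omega
  have hr : rr (2 ^ n + j) = σ j - (j : ℤ) ^ 2 := by
    unfold rr
    rw [hlog, Nat.add_sub_cancel_left, hn, Nat.unpair_pair, Encodable.encodek]
    simp only [Option.getD_some]
    rw [List.getD_eq_getElem _ _ (by simp [hlst]; omega)]
    simp [hlst]
  have hb : (σ j - (j : ℤ) ^ 2).natAbs ≤ X :=
    Finset.single_le_sum (f := fun j : ℕ => (σ j - (j : ℤ) ^ 2).natAbs)
      (fun _ _ => Nat.zero_le _) (Finset.mem_range.2 (by omega))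
  have hb2 : |σ j - (j : ℤ) ^ 2| ≤ X := by
    rw [Int.abs_eq_natAbs]; exact_mod_cast hb
  refine ⟨2 ^ n + j, show 1 ≤ 2 ^ n + j by omega, ?_⟩
  unfold aa
  rw [hr, if_pos]
  · push_cast
    ring
  · constructor
    · refine le_trans ?_ (hk0 _ (by omega))
      rw [← sq_abs]
      have : |((σ j - (j : ℤ) ^ 2 : ℤ) : ℝ)| ≤ X := by exact_mod_cast hb2
      gcongr
    · have h1 := (abs_le.1 hb2).1
      have h2 : (X : ℤ) + 1 ≤ ((2 ^ n + j : ℕ) : ℤ) := by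
        exact_mod_cast (by omega : X + 1 ≤ 2 ^ n + j)
      have h3 : ((2 ^ n + j : ℕ) : ℤ) ≤ ((2 ^ n + j : ℕ) : ℤ) ^ 2 := by
        have : (0 : ℤ) ≤ (X : ℤ) := by positivity
        nlinarith
      linarith

lemma tim_of_SM {F : ℕ → AddCircle (2 * π) → ℂ} {f : AddCircle (2 * π) → ℂ}
    (h : ∀ κ : ℝ, 0 < κ → ∃ n0 : ℕ, ∀ n : ℕ, n0 ≤ n → SM (fun t => F n t - f t) κ) :
    TendstoInMeasure volume F atTop f := by
  rw [tendstoInMeasure_iff_measureReal_norm]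
  intro ε hε
  rw [Metric.tendsto_atTop]
  intro δ hδ
  obtain ⟨n0, hn0⟩ := h (min ε δ / 2) (by positivity)
  refine ⟨n0, fun n hn => ?_⟩
  rw [Real.dist_0_eq_abs, abs_of_nonneg measureReal_nonneg]
  have h1 := min_le_left ε δ
  have h2 := min_le_right ε δ
  have h3 : 0 < min ε δ := by positivity
  refine lt_of_le_of_lt ((measureReal_mono ?_).trans (hn0 n hn)) (by linarith)
  intro t ht
  have ht' : ε ≤ ‖F n t - f t‖ := ht
  show min ε δ / 2 < ‖F n t - f t‖
  linarith

end Rep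

theorem analytic_representation_perturbed_squares (w : ℕ → ℝ) (hwpos : ∀ k, 0 < w k)
    (hw : Tendsto w atTop atTop) :
    ∃ a : ℕ → ℤ,
      Tendsto (fun k => (|a k - (k : ℤ) ^ 2| : ℝ) / w k) atTop (𝓝 0) ∧
      (a '' {k : ℕ | 1 ≤ k}) ⊆ {n : ℤ | 0 < n} ∧
      ∀ f : AddCircle (2 * π) → ℂ, Measurable f →
        ∃ c : ℤ → ℂ,
          TendstoInMeasure volume
            (fun N => lambdaPartialSum (a '' {k : ℕ | 1 ≤ k}) c N) atTop f := by
  have hpos : (Rep.aa w '' {k : ℕ | 1 ≤ k}) ⊆ {n : ℤ | 0 < n} := by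
    rintro _ ⟨k, hk, rfl⟩
    exact Rep.aa_pos w hk
  refine ⟨Rep.aa w, ?_, hpos, fun f hf => ?_⟩
  · simpa using Rep.aa_tendsto w hwpos hw
  · obtain ⟨c, hc, hS⟩ := Rep.main3 (fun k hk => hpos hk) (Rep.BP_of_star (Rep.aa_star w hw)) hf
    refine ⟨c, Rep.tim_of_SM fun κ hκ => ?_⟩
    obtain ⟨n0, hn0⟩ := hS κ hκ
    refine ⟨n0, fun n hn => (hn0 n hn).of_le fun t => le_of_eq ?_⟩
    unfold lambdaPartialSum
    congr 2
    refine Finset.sum_congr rfl fun k _ => ?_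
    congr 1
    by_cases hk : k ∈ Rep.aa w '' {k : ℕ | 1 ≤ k}
    · exact Set.indicator_of_mem hk c
    · rw [Set.indicator_of_notMem hk]
      by_contra h
      exact hk (hc k (Ne.symm h))
end

section
/- The representation theorem in measure fails for a bounded perturbation of the squares: if (a_k)_{k≥1} is an integer sequence with sup_k |a_k − k²| < ∞ and Λ = {a_k : k ≥ 1} ⊆ ℤ⁺, then there exists a measurable function f : 𝕋 → ℂ which admits no representation f(t) = ∑_{k∈Λ} c_k e^{ikt} with partial sums S_N(t) = ∑_{k∈Λ, k≤N} c_k e^{ikt} converging to f in Lebesgue measure on 𝕋. -/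
open MeasureTheory Filter Topology Real

lemma exists_missed_residue (M : ℕ) : ∃ (Q : ℕ) (s : ℤ), 0 < Q ∧
    ∀ (k : ℕ) (b : ℤ), |b - (k : ℤ) ^ 2| ≤ M → ¬ (Q : ℤ) ∣ b - s := by
  let p : ℕ → ℕ := fun i => Nat.nth Nat.Prime (i + 1)
  have hp : ∀ i, (p i).Prime := fun i => Nat.prime_nth_prime _
  have hinj : Function.Injective p := by
    intro i j h
    have := Nat.nth_injective Nat.infinite_setOfPred_prime h
    omega
  have hp2 : ∀ i, p i ≠ 2 := by
    intro i h
    have h0 : Nat.nth Nat.Prime 0 = 2 := Nat.nth_prime_zero_eq_two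
    have := Nat.nth_injective Nat.infinite_setOfPred_prime (h.trans h0.symm)
    omega
  have hns : ∀ i, ∃ x : ZMod (p i), ¬ IsSquare x := by
    intro i
    have : Fact (p i).Prime := ⟨hp i⟩
    apply FiniteField.exists_nonsquare
    rw [ZMod.ringChar_zmod_n]
    exact hp2 i
  choose n hn using hns
  let r : ℕ → ℕ := fun i => (n i + ((((i : ℤ) - M : ℤ)) : ZMod (p i))).val
  obtain ⟨x, hx⟩ := Nat.chineseRemainderOfFinset r p (Finset.range (2 * M + 1))
    (fun i _ => (hp i).ne_zero)
    (fun i _ j _ hij => (Nat.coprime_primes (hp i) (hp j)).2 (fun h => hij (hinj h)))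
  refine ⟨∏ i ∈ Finset.range (2 * M + 1), p i, x, Finset.prod_pos fun i _ => (hp i).pos, ?_⟩
  intro k b hb hdvd
  rw [abs_le] at hb
  obtain ⟨i, hi⟩ : ∃ i : ℕ, (i : ℤ) = b - (k : ℤ) ^ 2 + M :=
    ⟨(b - (k : ℤ) ^ 2 + M).toNat, by rw [Int.toNat_of_nonneg]; linarith⟩
  have hi' : i ∈ Finset.range (2 * M + 1) := by
    rw [Finset.mem_range]
    have : (i : ℤ) ≤ 2 * M := by linarith
    omega
  have : Fact (p i).Prime := ⟨hp i⟩
  have h1 : ((p i : ℕ) : ℤ) ∣ b - x :=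
    (Int.natCast_dvd_natCast.2 (Finset.dvd_prod_of_mem p hi')).trans hdvd
  have h2 : ((x : ℕ) : ZMod (p i)) = (r i : ℕ) := (ZMod.natCast_eq_natCast_iff _ _ _).2 (hx i hi')
  have h3 : ((b - x : ℤ) : ZMod (p i)) = 0 := (ZMod.intCast_zmod_eq_zero_iff_dvd _ _).2 h1
  apply hn i
  refine ⟨(k : ZMod (p i)), ?_⟩
  have h4 : (r i : ZMod (p i)) = n i + ((((i : ℤ) - M : ℤ)) : ZMod (p i)) :=
    ZMod.natCast_zmod_val _
  have h5 : (i : ℤ) - M = b - (k : ℤ) ^ 2 := by linarith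
  rw [h5] at h4
  push_cast at h3 h4
  rw [h2, h4] at h3
  linear_combination -h3

lemma fourier_add_pt (n : ℤ) (x y : AddCircle (2 * π)) :
    fourier n (x + y) = fourier n x * (fourier n y : ℂ) := by
  simp [fourier_apply, smul_add, AddCircle.toCircle_add]

lemma fourier_nsmul_pt (n : ℤ) (j : ℕ) (y : AddCircle (2 * π)) :
    fourier n (j • y) = (fourier n y : ℂ) ^ j := by
  induction j with
  | zero => simp [fourier_apply]
  | succ j ih => rw [succ_nsmul, fourier_add_pt, ih, pow_succ]

lemma fourier_root_pow (Q : ℕ) (hQ : 0 < Q) (m : ℤ) :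
    (fourier m (((2 * π / Q : ℝ)) : AddCircle (2 * π)) : ℂ) ^ Q = 1 := by
  rw [← fourier_nsmul_pt, ← AddCircle.coe_nsmul, nsmul_eq_mul]
  have : (Q : ℝ) * (2 * π / Q) = 2 * π := by field_simp
  rw [this, AddCircle.coe_period]
  simp [fourier_apply]

lemma fourier_root_ne (Q : ℕ) (hQ : 0 < Q) (m : ℤ) (hm : ¬ (Q : ℤ) ∣ m) :
    (fourier m (((2 * π / Q : ℝ)) : AddCircle (2 * π)) : ℂ) ≠ 1 := by
  intro h
  rw [fourier_coe_apply, Complex.exp_eq_one_iff] at h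
  obtain ⟨l, hl⟩ := h
  apply hm
  refine ⟨l, ?_⟩
  have hQ' : (Q : ℂ) ≠ 0 := by exact_mod_cast hQ.ne'
  have hpi : (π : ℂ) ≠ 0 := by exact_mod_cast Real.pi_ne_zero
  push_cast at hl
  have hI := Complex.I_ne_zero
  field_simp at hl
  have : (m : ℂ) = Q * l := by linear_combination hl
  exact_mod_cast this

/-- Twisted averages over the `Q`-torsion points kill frequencies not congruent to `s`. -/
lemma twisted_sum (Q : ℕ) (hQ : 0 < Q) (s k : ℤ) (hk : ¬ (Q : ℤ) ∣ k - s)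
    (t : AddCircle (2 * π)) :
    ∑ j ∈ Finset.range Q, (fourier (-s) (j • (((2 * π / Q : ℝ)) : AddCircle (2 * π))) : ℂ) *
      fourier k (t + j • (((2 * π / Q : ℝ)) : AddCircle (2 * π))) = 0 := by
  set τ : AddCircle (2 * π) := ((2 * π / Q : ℝ) : AddCircle (2 * π)) with hτ
  have h1 : ∀ j : ℕ, (fourier (-s) (j • τ) : ℂ) * fourier k (t + j • τ) =
      fourier k t * (fourier (k - s) τ : ℂ) ^ j := by
    intro j
    rw [fourier_add_pt, sub_eq_add_neg, ← fourier_nsmul_pt, fourier_add]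
    ring
  simp_rw [h1]
  rw [← Finset.mul_sum]
  have h2 := geom_sum_mul (fourier (k - s) τ : ℂ) Q
  rw [fourier_root_pow Q hQ, sub_self] at h2
  rcases mul_eq_zero.1 h2 with h | h
  · rw [h, mul_zero]
  · exact absurd (sub_eq_zero.1 h) (fourier_root_ne Q hQ _ hk)

lemma ae_translate {P : AddCircle (2 * π) → Prop} (h : ∀ᵐ t, P t) (y : AddCircle (2 * π)) :
    ∀ᵐ t, P (t + y) := by
  have hq : Measure.QuasiMeasurePreserving (fun t : AddCircle (2 * π) => t + y)
      volume volume := (measurePreserving_add_right _ y).quasiMeasurePreserving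
  exact hq.ae h

/-- **Sharpness of Theorem 6**: the representation theorem in measure fails for a
bounded perturbation of the squares `Λ = {a_k : k ≥ 1} ⊆ ℤ⁺`,
`sup_k |a_k - k²| < ∞`. -/
theorem no_representation_in_measure_bounded_perturbation_of_squares (a : ℕ → ℤ)
    (ha : ∃ C : ℝ, ∀ k : ℕ, 1 ≤ k → (|a k - (k : ℤ) ^ 2| : ℝ) ≤ C)
    (hpos : (a '' {k : ℕ | 1 ≤ k}) ⊆ {n : ℤ | 0 < n}) :
    ∃ f : AddCircle (2 * π) → ℂ, Measurable f ∧
      ¬ ∃ c : ℤ → ℂ,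
        TendstoInMeasure volume
          (fun N => lambdaPartialSum (a '' {k : ℕ | 1 ≤ k}) c N) atTop f := by
  obtain ⟨C, hC⟩ := ha
  obtain ⟨Q, s, hQ, hs⟩ := exists_missed_residue ⌈C⌉₊
  have hmiss : ∀ k ∈ a '' {k : ℕ | 1 ≤ k}, ¬ (Q : ℤ) ∣ k - s := by
    rintro _ ⟨k, hk, rfl⟩
    apply hs k
    have h1 := (hC k hk).trans (Nat.le_ceil C)
    exact_mod_cast h1
  refine ⟨fun t => fourier s t, (map_continuous (fourier s)).measurable, ?_⟩
  rintro ⟨c, hc⟩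
  obtain ⟨u, -, hu⟩ := hc.exists_seq_tendsto_ae
  set τ : AddCircle (2 * π) := ((2 * π / Q : ℝ) : AddCircle (2 * π)) with hτ
  have hall : ∀ᵐ t : AddCircle (2 * π), ∀ j : ℕ,
      Tendsto (fun i => lambdaPartialSum (a '' {k : ℕ | 1 ≤ k}) c (u i) (t + j • τ)) atTop
        (𝓝 (fourier s (t + j • τ))) := by
    rw [ae_all_iff]
    intro j
    exact ae_translate hu (j • τ)
  have : NeZero (volume : Measure (AddCircle (2 * π))) := ⟨by
    intro h
    have h1 := AddCircle.measure_univ (2 * π)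
    rw [h] at h1
    have : (0 : ℝ) < 2 * π := by positivity
    have h2 := ENNReal.ofReal_pos.2 this
    simp at h1
    linarith [Real.pi_pos]⟩
  obtain ⟨t, ht⟩ := hall.exists
  have hlim := tendsto_finsetSum (Finset.range Q)
    (fun j _ => (ht j).const_mul (fourier (-s) (j • τ) : ℂ))
  have hzero : ∀ N, ∑ j ∈ Finset.range Q, (fourier (-s) (j • τ) : ℂ) *
      lambdaPartialSum (a '' {k : ℕ | 1 ≤ k}) c N (t + j • τ) = 0 := by
    intro N
    unfold lambdaPartialSum
    simp_rw [Finset.mul_sum]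
    rw [Finset.sum_comm]
    apply Finset.sum_eq_zero
    intro k _
    by_cases hk : k ∈ a '' {k : ℕ | 1 ≤ k}
    · have h := twisted_sum Q hQ s k (hmiss k hk) t
      rw [← hτ] at h
      simp_rw [mul_left_comm _ (Set.indicator _ c k)]
      rw [← Finset.mul_sum, h, mul_zero]
    · simp [Set.indicator_of_notMem hk]
  simp only [hzero] at hlim
  have h0 := tendsto_nhds_unique tendsto_const_nhds hlim
  have h1 : ∀ j : ℕ, (fourier (-s) (j • τ) : ℂ) * fourier s (t + j • τ) = fourier s t := by
    intro j
    rw [fourier_add_pt, mul_left_comm, ← fourier_add, neg_add_cancel, fourier_zero, mul_one]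
  simp only [h1, Finset.sum_const, Finset.card_range, nsmul_eq_mul] at h0
  rcases mul_eq_zero.1 h0.symm with h | h
  · exact hQ.ne' (by exact_mod_cast h)
  · have : ‖(fourier s t : ℂ)‖ = 1 := by rw [fourier_apply]; exact Circle.norm_coe _
    rw [h, norm_zero] at this
    exact zero_ne_one this
end

section
/- If a set Λ ⊆ ℤ⁺ contains arbitrarily long segments of consecutive integers (for every L ∈ ℕ there exists a ∈ ℤ⁺ with {a, a+1, …, a+L} ⊆ Λ), then every measurable function f : 𝕋 → ℂ admits a representation f(t) = ∑_{k∈Λ} c_k e^{ikt} converging in measure; that is, the partial sums S_N(t) = ∑_{k∈Λ, k≤N} c_k e^{ikt} converge to f in Lebesgue measure on 𝕋. -/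
open MeasureTheory Filter Topology Real

namespace Seg

/-- The circle. -/
abbrev TT := AddCircle (2 * π)

/-- Normalised Haar measure. -/
noncomputable abbrev mu : Measure TT := AddCircle.haarAddCircle

lemma norm_fourier (n : ℤ) (t : TT) : ‖fourier n t‖ = 1 := by
  rw [fourier_apply]; exact Circle.norm_coe _

lemma integral_fourier (n : ℤ) : ∫ t : TT, fourier n t ∂mu = if n = 0 then 1 else 0 := by
  have h := congrFun (fourierCoeff_fourier (T := 2 * π) n) 0
  simp only [fourierCoeff, neg_zero, fourier_zero, one_smul] at h
  rw [h, Pi.single_apply]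
  simp [eq_comm]

lemma cont_integrable {f : TT → ℂ} (hf : Continuous f) : Integrable f mu :=
  hf.integrable_of_hasCompactSupport (HasCompactSupport.of_compactSpace f)

lemma cont_integrableR {f : TT → ℝ} (hf : Continuous f) : Integrable f mu :=
  hf.integrable_of_hasCompactSupport (HasCompactSupport.of_compactSpace f)

/-- Uniform approximation by trigonometric polynomials. -/
lemma trig_approx (g : C(TT, ℂ)) {ε : ℝ} (hε : 0 < ε) :
    ∃ (d : ℕ) (c : ℤ → ℂ), (∀ k, c k ≠ 0 → |k| ≤ d) ∧
      ∀ t, ‖g t - ∑ k ∈ Finset.Icc (-(d : ℤ)) d, c k * fourier k t‖ ≤ ε := by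
  have hg : g ∈ (Submodule.span ℂ (Set.range <| @fourier (2 * π))).topologicalClosure := by
    rw [span_fourier_closure_eq_top]; trivial
  have hg' := Metric.mem_closure_iff.1 hg ε hε
  obtain ⟨p, hp, hd⟩ := hg'
  obtain ⟨c, hc⟩ := (Finsupp.mem_span_range_iff_exists_finsupp).1 hp
  refine ⟨c.support.sup (fun k => k.natAbs), c, ?_, ?_⟩
  · intro k hk
    have := Finset.le_sup (f := fun k : ℤ => k.natAbs) (Finsupp.mem_support_iff.2 hk)
    rw [Int.abs_eq_natAbs]
    exact_mod_cast this
  · intro t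
    have h1 : ∑ k ∈ Finset.Icc (-((c.support.sup (fun k => k.natAbs) : ℕ) : ℤ))
        (c.support.sup (fun k => k.natAbs) : ℕ), c k * fourier k t = p t := by
      rw [← hc, Finsupp.sum, ContinuousMap.sum_apply]
      symm
      apply Finset.sum_subset_zero_on_sdiff
      · intro k hk
        have := Finset.le_sup (f := fun k : ℤ => k.natAbs) hk
        rw [Finset.mem_Icc]
        omega
      · intro k hk
        simp only [Finset.mem_sdiff, Finsupp.mem_support_iff, not_not] at hk
        simp [hk.2]
      · intro k hk
        simp
    rw [h1, ← ContinuousMap.sub_apply]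
    refine (ContinuousMap.norm_coe_le_norm _ t).trans ?_
    rw [← dist_eq_norm]; exact hd.le

lemma riemann_lebesgue (h : C(TT, ℂ)) :
    Tendsto (fun a : ℤ => ∫ t, h t * fourier a t ∂mu) atTop (𝓝 0) := by
  rw [Metric.tendsto_atTop]
  intro ε hε
  obtain ⟨d, c, hc, hd⟩ := trig_approx h (half_pos hε)
  refine ⟨d + 1, fun a ha => ?_⟩
  have h0 : ∫ t, (∑ k ∈ Finset.Icc (-(d : ℤ)) d, c k * fourier k t) * fourier a t ∂mu = 0 := by
    have : ∀ t : TT, (∑ k ∈ Finset.Icc (-(d : ℤ)) d, c k * fourier k t) * fourier a t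
        = ∑ k ∈ Finset.Icc (-(d : ℤ)) d, c k * fourier (k + a) t := by
      intro t
      rw [Finset.sum_mul]
      refine Finset.sum_congr rfl fun k _ => ?_
      rw [fourier_add, mul_assoc]
    simp_rw [this]
    rw [integral_finsetSum]
    · refine Finset.sum_eq_zero fun k hk => ?_
      rw [integral_const_mul, integral_fourier, if_neg, mul_zero]
      rw [Finset.mem_Icc] at hk
      omega
    · intro k _
      exact cont_integrable (by fun_prop)
  rw [dist_zero_right]
  have h1 : ∫ t, h t * fourier a t ∂mu = ∫ t, (h t - ∑ k ∈ Finset.Icc (-(d : ℤ)) d, c k * fourier k t) * fourier a t ∂mu := by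
    rw [← sub_zero (∫ t, h t * fourier a t ∂mu), ← h0, ← integral_sub]
    · simp_rw [sub_mul]
    · exact cont_integrable (by fun_prop)
    · exact cont_integrable (by fun_prop)
  rw [h1]
  refine (norm_integral_le_of_norm_le_const (C := ε / 2) ?_).trans_lt ?_
  · refine Eventually.of_forall fun t => ?_
    rw [norm_mul, norm_fourier, mul_one]; exact hd t
  · simp; exact hε

lemma fourier_pow (a : ℤ) (m : ℕ) (t : TT) : (fourier a t) ^ m = fourier ((m : ℤ) * a) t := by
  induction m with
  | zero => simp
  | succ m ih => rw [pow_succ, ih, ← fourier_add]; congr 2; push_cast; ring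

lemma one_sub_ne {z : ℂ} (hz : ‖z‖ ≤ 1 / 2) : 1 - z ≠ 0 := by
  intro h
  have : z = 1 := by linear_combination -h
  rw [this] at hz; norm_num at hz

lemma log_step (q : C(TT, ℂ)) (hq : ∀ t, ‖q t‖ ≤ 1 / 2) :
    Tendsto (fun a : ℤ => ∫ t, Real.log ‖1 - q t * fourier a t‖ ∂mu) atTop (𝓝 0) := by
  rw [Metric.tendsto_atTop]
  intro ε hε
  obtain ⟨n, hn⟩ := exists_pow_lt_of_lt_one (half_pos hε) (show (1/2 : ℝ) < 1 by norm_num)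
  have hT : Tendsto (fun a : ℤ => ∫ t, Complex.logTaylor (n + 1) (-(q t * fourier a t)) ∂mu)
      atTop (𝓝 0) := by
    have : ∀ a : ℤ, ∫ t, Complex.logTaylor (n + 1) (-(q t * fourier a t)) ∂mu
        = ∑ j ∈ Finset.range (n + 1), (-1) ^ (j + 1) * (-1) ^ j / (j : ℂ) *
          ∫ t, (q t) ^ j * fourier ((j : ℤ) * a) t ∂mu := by
      intro a
      simp only [Complex.logTaylor]
      rw [integral_finsetSum]
      · refine Finset.sum_congr rfl fun j _ => ?_
        rw [← integral_const_mul]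
        congr 1
        ext t
        rw [neg_pow (q t * _), mul_pow, fourier_pow]; ring
      · intro j _
        exact cont_integrable (by fun_prop)
    simp_rw [this]
    rw [show (0:ℂ) = ∑ j ∈ Finset.range (n + 1), (-1) ^ (j + 1) * (-1) ^ j / (j : ℂ) * 0 by simp]
    refine tendsto_finsetSum _ fun j _ => ?_
    rcases Nat.eq_zero_or_pos j with rfl | hj
    · simp
    · refine Tendsto.const_mul _ ?_
      have h2 : Tendsto (fun a : ℤ => (j : ℤ) * a) atTop atTop :=
        tendsto_id.const_mul_atTop' (by exact_mod_cast hj)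
      have h3 := (riemann_lebesgue ⟨fun t => q t ^ j, by fun_prop⟩).comp h2
      simpa only [Function.comp_def, ContinuousMap.coe_mk] using h3
  obtain ⟨A, hA⟩ := (Metric.tendsto_atTop.1 hT) (ε / 2) (half_pos hε)
  refine ⟨A, fun a ha => ?_⟩
  have hA := hA a ha
  rw [dist_zero_right] at hA ⊢
  have hz : ∀ t, ‖-(q t * fourier a t)‖ ≤ 1 / 2 := fun t => by
    rw [norm_neg, norm_mul, norm_fourier, mul_one]; exact hq t
  have hcl : Continuous fun t : TT => Real.log ‖1 - q t * fourier a t‖ := by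
    refine Continuous.log (by fun_prop) fun t => ?_
    exact norm_ne_zero_iff.2 (one_sub_ne (by rw [← norm_neg]; exact hz t))
  have hct : Continuous fun t : TT => Complex.logTaylor (n + 1) (-(q t * fourier a t)) := by
    simp only [Complex.logTaylor]; fun_prop
  have key : ∀ t, ‖Real.log ‖1 - q t * fourier a t‖
      - (Complex.logTaylor (n + 1) (-(q t * fourier a t))).re‖ ≤ (1 / 2) ^ n := by
    intro t
    have h1 := Complex.norm_log_sub_logTaylor_le n (z := -(q t * fourier a t))
      ((hz t).trans_lt (by norm_num))
    rw [show Real.log ‖1 - q t * fourier a t‖ = (Complex.log (1 + -(q t * fourier a t))).re by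
      rw [Complex.log_re, sub_eq_add_neg], ← Complex.sub_re, Real.norm_eq_abs]
    refine (Complex.abs_re_le_norm _).trans (h1.trans ?_)
    have h2 := hz t
    set x := ‖-(q t * fourier a t)‖
    have hx0 : 0 ≤ x := norm_nonneg _
    have h3 : (1 - x)⁻¹ ≤ 2 := by
      rw [inv_le_comm₀ (by linarith) (by norm_num)]; linarith
    have h4 : x ^ (n + 1) ≤ (1 / 2) ^ (n + 1) := pow_le_pow_left₀ hx0 h2 _
    calc x ^ (n + 1) * (1 - x)⁻¹ / (n + 1) ≤ (1 / 2) ^ (n + 1) * 2 / 1 := by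
          have h5 : 0 ≤ (1 - x)⁻¹ := inv_nonneg.2 (by linarith)
          have h6 : (1 : ℝ) ≤ n + 1 := by linarith [Nat.cast_nonneg (α := ℝ) n]
          gcongr
      _ = (1 / 2) ^ n := by rw [pow_succ]; ring
  have e1 : ∫ t, (Complex.logTaylor (n + 1) (-(q t * fourier a t))).re ∂mu
      = (∫ t, Complex.logTaylor (n + 1) (-(q t * fourier a t)) ∂mu).re := by
    have := (Complex.reCLM).integral_comp_comm (cont_integrable hct)
    simpa using this
  have e2 : ∫ t, Real.log ‖1 - q t * fourier a t‖ ∂mu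
      = (∫ t, (Real.log ‖1 - q t * fourier a t‖
      - (Complex.logTaylor (n + 1) (-(q t * fourier a t))).re) ∂mu) +
        (∫ t, Complex.logTaylor (n + 1) (-(q t * fourier a t)) ∂mu).re := by
    rw [integral_sub (cont_integrableR hcl), e1]
    · ring
    · exact cont_integrableR (by fun_prop)
  rw [e2]
  refine (norm_add_le _ _).trans_lt ?_
  have h5 := norm_integral_le_of_norm_le_const (μ := mu) (Eventually.of_forall key)
  have h6 := Complex.abs_re_le_norm (∫ t, Complex.logTaylor (n + 1) (-(q t * fourier a t)) ∂mu)
  simp only [probReal_univ, mul_one] at h5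
  rw [Real.norm_eq_abs (Complex.re _)]
  linarith

lemma sq_step (D q : C(TT, ℂ)) :
    Tendsto (fun a : ℤ => ∫ t, ‖D t * (1 - q t * fourier a t)‖ ^ 2 ∂mu) atTop
      (𝓝 (∫ t, ‖D t‖ ^ 2 * (1 + ‖q t‖ ^ 2) ∂mu)) := by
  have hRL := riemann_lebesgue ⟨fun t => ((‖D t‖ ^ 2 : ℝ) : ℂ) * q t, by fun_prop⟩
  have h2 := (Complex.continuous_re.tendsto 0).comp hRL
  have h3 := (h2.const_mul 2).const_sub (∫ t, ‖D t‖ ^ 2 * (1 + ‖q t‖ ^ 2) ∂mu)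
  simp only [Complex.zero_re, mul_zero, sub_zero] at h3
  refine h3.congr fun a => ?_
  simp only [Function.comp, ContinuousMap.coe_mk]
  have hc : Continuous fun t : TT => ((‖D t‖ ^ 2 : ℝ) : ℂ) * q t * fourier a t := by fun_prop
  have e1 := (Complex.reCLM).integral_comp_comm (cont_integrable hc)
  simp only [Complex.reCLM_apply] at e1
  rw [← e1, ← integral_const_mul, ← integral_sub]
  · congr 1
    ext t
    have hn : ‖q t‖ = ‖q t * fourier a t‖ := by rw [norm_mul, norm_fourier, mul_one]
    rw [norm_mul, mul_pow, hn, mul_assoc, Complex.re_ofReal_mul, ← Complex.normSq_eq_norm_sq (1 - _),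
      ← Complex.normSq_eq_norm_sq (q t * _), Complex.normSq_apply, Complex.normSq_apply]
    simp only [Complex.sub_re, Complex.sub_im, Complex.one_re, Complex.one_im]
    ring
  · exact cont_integrableR (by fun_prop)
  · exact cont_integrableR (by fun_prop)

/-- Partial sums. -/
noncomputable def T (c : ℤ → ℂ) (M : ℕ) (t : TT) : ℂ :=
  ∑ k ∈ Finset.Icc (1 : ℤ) (M : ℤ), c k * fourier k t

/-- `Λ` contains long segments far away. -/
def IsSeg (Λ : Set ℤ) : Prop :=
  ∀ (L : ℕ) (N : ℤ), ∃ a : ℤ, N < a ∧ ∀ i : ℤ, |i| ≤ L → a + i ∈ Λ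

/-- The support of the coefficients lies in the part of Λ between the two bounds. -/
def Supp (Λ : Set ℤ) (c : ℤ → ℂ) (N N' : ℕ) : Prop :=
  ∀ k, c k ≠ 0 → k ∈ Λ ∧ (N : ℤ) < k ∧ k ≤ N'

lemma T_cont (c : ℤ → ℂ) (M : ℕ) : Continuous (T c M) := by
  unfold T; fun_prop

lemma T_add (c c' : ℤ → ℂ) (M : ℕ) (t : TT) : T (c + c') M t = T c M t + T c' M t := by
  simp only [T, Pi.add_apply, add_mul, Finset.sum_add_distrib]

lemma T_zero (M : ℕ) (t : TT) : T 0 M t = 0 := by simp [T]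

lemma T_of_le {Λ : Set ℤ} {c : ℤ → ℂ} {N N' M : ℕ} (h : Supp Λ c N N') (hM : M ≤ N) (t : TT) :
    T c M t = 0 := by
  refine Finset.sum_eq_zero fun k hk => ?_
  rw [Finset.mem_Icc] at hk
  have : c k = 0 := by
    by_contra hne
    have := (h k hne).2.1
    omega
  simp [this]

lemma T_of_ge {Λ : Set ℤ} {c : ℤ → ℂ} {N N' M : ℕ} (h : Supp Λ c N N') (hM : N' ≤ M) (t : TT) :
    T c M t = T c N' t := by
  symm
  refine Finset.sum_subset (Finset.Icc_subset_Icc_right (by exact_mod_cast hM)) fun k hk hk' => ?_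
  rw [Finset.mem_Icc] at hk hk'
  have : c k = 0 := by
    by_contra hne
    have := (h k hne).2
    omega
  simp [this]

lemma Supp.mono {Λ : Set ℤ} {c : ℤ → ℂ} {N N' N₁ N₁' : ℕ} (h : Supp Λ c N N') (h1 : N₁ ≤ N)
    (h2 : N' ≤ N₁') : Supp Λ c N₁ N₁' := by
  intro k hk
  have := h k hk
  refine ⟨this.1, ?_, ?_⟩ <;> omega

lemma Supp.add {Λ : Set ℤ} {c c' : ℤ → ℂ} {N N' : ℕ} (h : Supp Λ c N N') (h' : Supp Λ c' N N') :
    Supp Λ (c + c') N N' := by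
  intro k hk
  by_cases h0 : c k = 0
  · exact h' k (by simpa [h0] using hk)
  · exact h k h0

lemma parseval (s : Finset ℤ) (c : ℤ → ℂ) :
    ∫ t, ‖∑ k ∈ s, c k * fourier k t‖ ^ 2 ∂mu = ∑ k ∈ s, ‖c k‖ ^ 2 := by
  apply Complex.ofReal_injective
  rw [← integral_complex_ofReal]
  have : ∀ t : TT, ((‖∑ k ∈ s, c k * fourier k t‖ ^ 2 : ℝ) : ℂ)
      = ∑ k ∈ s, ∑ l ∈ s, c k * starRingEnd ℂ (c l) * fourier (k - l) t := by
    intro t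
    rw [Complex.ofReal_pow, ← Complex.mul_conj', map_sum, Finset.sum_mul_sum]
    refine Finset.sum_congr rfl fun k _ => Finset.sum_congr rfl fun l _ => ?_
    rw [sub_eq_add_neg, fourier_add, fourier_neg, map_mul]; ring
  simp_rw [this]
  rw [integral_finsetSum]
  · rw [Complex.ofReal_sum]
    refine Finset.sum_congr rfl fun k hk => ?_
    rw [integral_finsetSum]
    · simp_rw [integral_const_mul, integral_fourier]
      rw [Finset.sum_eq_single k]
      · simp [Complex.mul_conj']
      · intro l _ hl
        rw [if_neg (by omega), mul_zero]
      · intro h; exact absurd hk h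
    · intro l _
      exact cont_integrable (by fun_prop)
  · intro l _
    exact cont_integrable (by fun_prop)

lemma single_block {Λ : Set ℤ} (hΛ : IsSeg Λ) (g : C(TT, ℂ)) {ε K : ℝ} (hε : 0 < ε)
    (hK : ∀ t, ‖g t‖ ≤ K) (N : ℕ) (A : ℤ) :
    ∃ (a : ℤ) (N' : ℕ) (c : ℤ → ℂ), A ≤ a ∧ N ≤ N' ∧ Supp Λ c N N' ∧
      (∀ t, ‖T c N' t - g t * fourier a t‖ ≤ ε) ∧
      ∀ M, ∫ t, ‖T c M t‖ ^ 2 ∂mu ≤ (K + ε) ^ 2 := by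
  obtain ⟨d, c0, hc0, hd⟩ := trig_approx g hε
  obtain ⟨a, ha, hseg⟩ := hΛ d (max A (N + d))
  have haA : A < a := (le_max_left _ _).trans_lt ha
  have haN : (N + d : ℤ) < a := (le_max_right _ _).trans_lt ha
  obtain ⟨N', hN'⟩ : ∃ N' : ℕ, (N' : ℤ) = a + d := ⟨(a + d).toNat, by omega⟩
  have hS : Supp Λ (fun k => c0 (k - a)) N N' := by
    intro k hk
    have h1 := hc0 _ hk
    have h2 := hseg _ h1
    rw [abs_le] at h1
    refine ⟨by simpa using h2, ?_, ?_⟩ <;> omega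
  have hT : ∀ t, ‖T (fun k => c0 (k - a)) N' t - g t * fourier a t‖ ≤ ε := by
    intro t
    have e1 : T (fun k => c0 (k - a)) N' t
        = (∑ k ∈ Finset.Icc (-(d : ℤ)) d, c0 k * fourier k t) * fourier a t := by
      rw [Finset.sum_mul]
      have e2 : ∑ k ∈ Finset.Icc (-(d : ℤ)) d, c0 k * fourier k t * fourier a t
        = ∑ k ∈ Finset.Icc (a - d) (a + d), c0 (k - a) * fourier k t := by
        refine Finset.sum_bij (fun k _ => k + a) ?_ ?_ ?_ ?_
        · intro k hk; rw [Finset.mem_Icc] at hk ⊢; omega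
        · intro k _ l _ h; omega
        · intro k hk
          rw [Finset.mem_Icc] at hk
          exact ⟨k - a, by rw [Finset.mem_Icc]; omega, by omega⟩
        · intro k _
          rw [fourier_add, add_sub_cancel_right]; ring
      rw [e2, T]
      symm
      apply Finset.sum_subset
      · intro k hk; rw [Finset.mem_Icc] at hk ⊢; omega
      · intro k hk hk'
        have : c0 (k - a) = 0 := by
          by_contra hne
          have := hc0 _ hne
          rw [abs_le] at this
          rw [Finset.mem_Icc] at hk'
          omega
        simp [this]
    rw [e1, ← sub_mul, norm_mul, norm_fourier, mul_one, norm_sub_rev]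
    exact hd t
  refine ⟨a, N', _, haA.le, by omega, hS, hT, fun M => ?_⟩
  calc ∫ t, ‖T (fun k => c0 (k - a)) M t‖ ^ 2 ∂mu
      ≤ ∫ t, ‖T (fun k => c0 (k - a)) (max M N') t‖ ^ 2 ∂mu := by
        simp only [T]
        rw [parseval, parseval]
        exact Finset.sum_le_sum_of_subset_of_nonneg
          (Finset.Icc_subset_Icc_right (by simp)) (fun _ _ _ => by positivity)
    _ = ∫ t, ‖T (fun k => c0 (k - a)) N' t‖ ^ 2 ∂mu := by
        simp_rw [T_of_ge hS (le_max_right M N')]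
    _ ≤ ∫ t : TT, (K + ε) ^ 2 ∂mu := by
        refine integral_mono (cont_integrableR ?_) (integrable_const _) fun t => ?_
        · have := T_cont (fun k => c0 (k - a)) N'
          fun_prop
        · have h1 := norm_le_norm_add_norm_sub' (T (fun k => c0 (k - a)) N' t) (g t * fourier a t)
          have h2 := hT t
          have h3 := hK t
          have h4 : ‖g t * fourier a t‖ = ‖g t‖ := by rw [norm_mul, norm_fourier, mul_one]
          simp only
          gcongr
          linarith
    _ = (K + ε) ^ 2 := by simp

lemma markov_E {E : C(TT, ℂ)} {b x : ℝ} (hb : 0 ≤ b) (hx : 0 < x)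
    (hE : ∀ t, exp (-b - 2) ≤ ‖E t‖) (hI : ∫ t, Real.log ‖E t‖ ∂mu ≤ 1) :
    mu.real {t | exp x < ‖E t‖} ≤ (b + 3) / x := by
  have hpos : ∀ t, 0 < ‖E t‖ := fun t => (exp_pos _).trans_le (hE t)
  have hc : Continuous fun t => Real.log ‖E t‖ :=
    Continuous.log (by fun_prop) fun t => (hpos t).ne'
  have h1 := mul_meas_ge_le_integral_of_nonneg (μ := mu) (f := fun t => Real.log ‖E t‖ + (b + 2))
    (Eventually.of_forall fun t => by
      have := (Real.le_log_iff_exp_le (hpos t)).2 (hE t)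
      simp only [Pi.zero_apply]; linarith)
    (cont_integrableR (by fun_prop)) x
  rw [integral_add (cont_integrableR hc) (integrable_const _)] at h1
  simp only [integral_const, probReal_univ, smul_eq_mul, one_mul] at h1
  have h2 : mu.real {t | exp x < ‖E t‖} ≤ mu.real {t | x ≤ Real.log ‖E t‖ + (b + 2)} := by
    refine measureReal_mono fun t ht => ?_
    have := (Real.lt_log_iff_exp_lt (hpos t)).2 ht
    simp only [Set.mem_ofPred_eq]
    linarith
  rw [le_div_iff₀ hx]
  nlinarith

lemma markov_sq {g : TT → ℂ} (hg : Continuous g) {κ δ : ℝ} (hδ : 0 < δ) (hδ1 : δ ≤ 1)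
    (hκ0 : 0 ≤ κ) (hκ : κ ≤ δ ^ 2) (hI : ∫ t, ‖g t‖ ^ 2 ∂mu ≤ κ ^ 2) :
    mu.real {t | δ < ‖g t‖} ≤ δ := by
  have h1 := mul_meas_ge_le_integral_of_nonneg (μ := mu) (f := fun t => ‖g t‖ ^ 2)
    (Eventually.of_forall fun t => by simp) (cont_integrableR (by fun_prop)) (δ ^ 2)
  have h2 : mu.real {t | δ < ‖g t‖} ≤ mu.real {t | δ ^ 2 ≤ ‖g t‖ ^ 2} := by
    refine measureReal_mono fun t ht => ?_
    simp only [Set.mem_ofPred_eq] at ht ⊢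
    gcongr
  have h3 : κ ^ 2 ≤ (δ ^ 2) ^ 2 := by gcongr
  have h4 : δ ^ 2 * mu.real {t | δ < ‖g t‖} ≤ δ ^ 2 * δ ^ 2 := by nlinarith [sq_nonneg δ]
  have h5 := le_of_mul_le_mul_left h4 (by positivity)
  nlinarith

lemma E_step {E : C(TT, ℂ)} {b B r : ℝ} (hr : 0 < r) (hr2 : r ≤ 1 / 2)
    (hE : ∀ t, exp (-b - 2) ≤ ‖E t‖ ∧ ‖E t‖ ≤ exp (B + 2)) {ε τ : ℝ} (hε : 0 < ε) :
    ∃ (q : C(TT, ℂ)) (A : ℤ), (∀ t, ‖q t‖ ≤ r) ∧ ∀ a, A ≤ a →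
      (∀ t, exp (-b - 2) ≤ ‖E t * (1 - q t * fourier a t)‖ ∧
        ‖E t * (1 - q t * fourier a t)‖ ≤ exp (B + 2)) ∧
      ∫ t, Real.log ‖E t * (1 - q t * fourier a t)‖ ∂mu ≤ ∫ t, Real.log ‖E t‖ ∂mu + ε ∧
      (τ ≤ mu.real {t | exp (-b) ≤ ‖E t‖ ∧ ‖E t‖ ≤ exp B} →
        ∫ t, ‖E t‖ ^ 2 ∂mu + (r ^ 2 * exp (-b) ^ 2 * τ - ε) ≤
        ∫ t, ‖E t * (1 - q t * fourier a t)‖ ^ 2 ∂mu) := by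
  have hpos : ∀ t, 0 < ‖E t‖ := fun t => (exp_pos _).trans_le (hE t).1
  have hc : Continuous fun t => Real.log ‖E t‖ :=
    Continuous.log (by fun_prop) fun t => (hpos t).ne'
  obtain ⟨φ, hφ⟩ : ∃ φ : ℝ → ℝ, φ = fun x => max 0 (min 1 (min (x + b + 1) (B + 1 - x))) := ⟨_, rfl⟩
  have hφc : Continuous φ := by rw [hφ]; fun_prop
  have hφ0 : ∀ x, 0 ≤ φ x := fun x => by rw [hφ]; exact le_max_left _ _
  have hφ1 : ∀ x, φ x ≤ 1 := fun x => by
    rw [hφ]; exact max_le zero_le_one (min_le_left _ _)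
  have hφin : ∀ x, -b ≤ x → x ≤ B → φ x = 1 := fun x h1 h2 => by
    rw [hφ]; simp only
    rw [min_eq_left (le_min (by linarith) (by linarith)), max_eq_right zero_le_one]
  have hφout : ∀ x, φ x ≠ 0 → -b - 1 ≤ x ∧ x ≤ B + 1 := fun x h => by
    by_contra hcon
    apply h
    rw [hφ]; simp only
    apply max_eq_left
    by_cases h1 : -b - 1 ≤ x
    · have h2 : ¬ x ≤ B + 1 := fun h2 => hcon ⟨h1, h2⟩
      exact (min_le_right _ _).trans ((min_le_right _ _).trans (by linarith))
    · exact (min_le_right _ _).trans ((min_le_left _ _).trans (by linarith))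
  let q : C(TT, ℂ) := ⟨fun t => ((r * φ (Real.log ‖E t‖) : ℝ) : ℂ), by fun_prop⟩
  have hqn : ∀ t, ‖q t‖ = r * φ (Real.log ‖E t‖) := fun t => by
    change ‖((r * φ (Real.log ‖E t‖) : ℝ) : ℂ)‖ = _
    rw [Complex.norm_real, Real.norm_eq_abs, abs_of_nonneg (mul_nonneg hr.le (hφ0 _))]
  have hq : ∀ t, ‖q t‖ ≤ r := fun t => by
    rw [hqn]; nlinarith [hφ1 (Real.log ‖E t‖)]
  have hL := log_step q fun t => (hq t).trans hr2
  have hS := sq_step E q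
  obtain ⟨A1, hA1⟩ := Metric.tendsto_atTop.1 hL ε hε
  obtain ⟨A2, hA2⟩ := Metric.tendsto_atTop.1 hS ε hε
  refine ⟨q, max A1 A2, hq, fun a ha => ⟨?_, ?_, ?_⟩⟩
  · intro t
    by_cases h0 : φ (Real.log ‖E t‖) = 0
    · have : q t = 0 := by rw [← norm_eq_zero, hqn, h0, mul_zero]
      simpa [this] using hE t
    · obtain ⟨h1, h2⟩ := hφout _ h0
      rw [Real.le_log_iff_exp_le (hpos t)] at h1
      rw [Real.log_le_iff_le_exp (hpos t)] at h2
      have hn : ‖q t * fourier a t‖ ≤ 1 / 2 := by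
        rw [norm_mul, norm_fourier, mul_one]; exact (hq t).trans hr2
      have h3 : ‖1 - q t * fourier a t‖ ≤ 3 / 2 := by
        refine (norm_sub_le _ _).trans ?_
        rw [norm_one]; linarith
      have h4 : 1 / 2 ≤ ‖1 - q t * fourier a t‖ := by
        have := norm_sub_norm_le 1 (q t * fourier a t)
        rw [norm_one] at this; linarith
      have e1 : exp (-1) ≤ 1 / 2 := by
        rw [exp_neg, one_div]
        have := Real.add_one_le_exp 1
        gcongr; linarith
      have e2 : 3 / 2 ≤ exp 1 := by
        have := Real.add_one_le_exp 1
        linarith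
      rw [norm_mul]
      constructor
      · rw [show -b - 2 = (-b - 1) + -1 by ring, exp_add]
        gcongr
        exact e1.trans h4
      · rw [show B + 2 = (B + 1) + 1 by ring, exp_add]
        gcongr
        exact h3.trans e2
  · have h1 := hA1 a ((le_max_left _ _).trans ha)
    rw [dist_zero_right, Real.norm_eq_abs] at h1
    have hne : ∀ t, 1 - q t * fourier a t ≠ 0 := fun t =>
      one_sub_ne (by rw [norm_mul, norm_fourier, mul_one]; exact (hq t).trans hr2)
    have : ∀ t, Real.log ‖E t * (1 - q t * fourier a t)‖
        = Real.log ‖E t‖ + Real.log ‖1 - q t * fourier a t‖ := fun t => by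
      rw [norm_mul, Real.log_mul (hpos t).ne' (norm_ne_zero_iff.2 (hne t))]
    simp_rw [this]
    rw [integral_add (cont_integrableR hc)]
    · linarith [le_abs_self (∫ t, Real.log ‖1 - q t * fourier a t‖ ∂mu)]
    · exact cont_integrableR (Continuous.log (by fun_prop) fun t => norm_ne_zero_iff.2 (hne t))
  · intro hτ
    have h1 := hA2 a ((le_max_right _ _).trans ha)
    rw [Real.dist_eq] at h1
    have h2 := (abs_lt.1 h1).1
    have h3 := mul_meas_ge_le_integral_of_nonneg (μ := mu) (f := fun t => ‖E t‖ ^ 2 * ‖q t‖ ^ 2)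
      (Eventually.of_forall fun t => by simp only [Pi.zero_apply]; positivity)
      (cont_integrableR (by fun_prop)) (r ^ 2 * exp (-b) ^ 2)
    have h4 : mu.real {t | exp (-b) ≤ ‖E t‖ ∧ ‖E t‖ ≤ exp B}
        ≤ mu.real {t | r ^ 2 * exp (-b) ^ 2 ≤ ‖E t‖ ^ 2 * ‖q t‖ ^ 2} := by
      refine measureReal_mono fun t ht => ?_
      obtain ⟨ht1, ht2⟩ := ht
      have ht3 := ht1
      rw [← Real.le_log_iff_exp_le (hpos t)] at ht3
      rw [← Real.log_le_iff_le_exp (hpos t)] at ht2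
      simp only [Set.mem_ofPred_eq]
      rw [hqn, hφin _ ht3 ht2, mul_one, mul_comm]
      gcongr
    have h5 : r ^ 2 * exp (-b) ^ 2 * τ ≤ ∫ t, ‖E t‖ ^ 2 * ‖q t‖ ^ 2 ∂mu := by
      refine le_trans ?_ h3
      gcongr
      exact hτ.trans h4
    have h6 : ∫ t, ‖E t‖ ^ 2 * (1 + ‖q t‖ ^ 2) ∂mu
        = ∫ t, ‖E t‖ ^ 2 ∂mu + ∫ t, ‖E t‖ ^ 2 * ‖q t‖ ^ 2 ∂mu := by
      rw [← integral_add]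
      · simp_rw [mul_add, mul_one]
      · exact cont_integrableR (by fun_prop)
      · exact cont_integrableR (by fun_prop)
    linarith

lemma process {Λ : Set ℤ} (hΛ : IsSeg Λ) (f : C(TT, ℂ)) {F b B r ε δ τ : ℝ} (hF : ∀ t, ‖f t‖ ≤ F)
    (hb : 0 ≤ b) (hB : 0 ≤ B) (hr : 0 < r) (hr2 : r ≤ 1 / 2) (hε : 0 < ε) (hδ : 0 < δ)
    (hδ1 : δ ≤ 1) (hK : F * exp (B + 2) * r + ε ≤ δ ^ 2) (N : ℕ) (n : ℕ) (hn : n * ε ≤ δ) :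
    ∃ (E : C(TT, ℂ)) (N' : ℕ) (c : ℤ → ℂ), N ≤ N' ∧ Supp Λ c N N' ∧
      (∀ t, exp (-b - 2) ≤ ‖E t‖ ∧ ‖E t‖ ≤ exp (B + 2)) ∧
      (∀ t, ‖f t * (1 - E t) - T c N' t‖ ≤ n * ε) ∧
      ∫ t, Real.log ‖E t‖ ∂mu ≤ n * ε ∧
      (∀ M x, 0 < x → mu.real {t | (1 + exp x) * ‖f t‖ + 2 * δ < ‖T c M t‖} ≤ (b + 3) / x + δ) ∧
      (mu.real {t | exp (-b) ≤ ‖E t‖ ∧ ‖E t‖ ≤ exp B} < τ ∨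
        n * (r ^ 2 * exp (-b) ^ 2 * τ - ε) ≤ ∫ t, ‖E t‖ ^ 2 ∂mu) := by
  have hF0 : 0 ≤ F := (norm_nonneg _).trans (hF 0)
  induction n with
  | zero =>
    refine ⟨1, N, 0, le_rfl, fun k hk => absurd rfl hk, ?_, ?_, ?_, ?_, Or.inr ?_⟩
    · intro t
      simp only [ContinuousMap.one_apply, norm_one]
      exact ⟨Real.exp_le_one_iff.2 (by linarith), Real.one_le_exp (by linarith)⟩
    · intro t; simp [T_zero]
    · simp
    · intro M x hx
      have : {t : TT | (1 + exp x) * ‖f t‖ + 2 * δ < ‖T 0 M t‖} = ∅ := by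
        ext t
        simp only [T_zero, norm_zero, Set.mem_ofPred_eq, Set.mem_empty_iff_false, iff_false, not_lt]
        positivity
      rw [this, measureReal_empty]
      positivity
    · simp
  | succ n ih =>
    push_cast at hn
    have hn' : n * ε ≤ δ := by linarith
    obtain ⟨E, N1, c, hN1, hS, hE, hfE, hlog, hpart, halt⟩ := ih hn'
    by_cases hτ : mu.real {t | exp (-b) ≤ ‖E t‖ ∧ ‖E t‖ ≤ exp B} < τ
    · refine ⟨E, N1, c, hN1, hS, hE, fun t => (hfE t).trans ?_, hlog.trans ?_, hpart, Or.inl hτ⟩ <;>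
      · push_cast; linarith
    have halt := halt.resolve_left hτ
    rw [not_lt] at hτ
    obtain ⟨q, A, hq, hA⟩ := E_step (τ := τ) hr hr2 hE hε
    have hg : ∀ t, ‖(f * E * q) t‖ ≤ F * exp (B + 2) * r := by
      intro t
      simp only [ContinuousMap.mul_apply, norm_mul]
      have := hF t
      have := (hE t).2
      have := hq t
      gcongr
    obtain ⟨a, N2, c2, ha, hN2, hS2, hT2, hL2⟩ := single_block hΛ (f * E * q) hε hg N1 A
    obtain ⟨hE', hlog', hsq'⟩ := hA a ha
    have hsq' := hsq' hτ
    refine ⟨⟨fun t => E t * (1 - q t * fourier a t), by fun_prop⟩, N2, c + c2, hN1.trans hN2,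
      (hS.mono le_rfl hN2).add (hS2.mono hN1 le_rfl), hE', ?_, ?_, ?_, Or.inr ?_⟩
    · intro t
      rw [T_add, T_of_ge hS hN2]
      have h1 := hfE t
      have h2 := hT2 t
      have e : f t * (1 - E t * (1 - q t * fourier a t)) - (T c N1 t + T c2 N2 t)
        = (f t * (1 - E t) - T c N1 t) - (T c2 N2 t - (f * E * q) t * fourier a t) := by
        simp only [ContinuousMap.mul_apply]; ring
      simp only [ContinuousMap.coe_mk]
      rw [e]
      refine (norm_sub_le _ _).trans ((add_le_add h1 h2).trans ?_)
      push_cast; linarith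
    · simp only [ContinuousMap.coe_mk]
      push_cast; linarith
    · intro M x hx
      rcases le_total M N1 with hM | hM
      · simp_rw [T_add, T_of_le hS2 hM, add_zero]
        exact hpart M x hx
      · have hsub : {t | (1 + exp x) * ‖f t‖ + 2 * δ < ‖T (c + c2) M t‖} ⊆
            {t | exp x < ‖E t‖} ∪ {t | δ < ‖T c2 M t‖} := by
          intro t ht
          by_contra hcon
          simp only [Set.mem_union, Set.mem_ofPred_eq, not_or, not_lt] at hcon ht
          rw [T_add, T_of_ge hS hM] at ht
          have h1 := hfE t
          have h2 : ‖f t * (1 - E t)‖ ≤ (1 + exp x) * ‖f t‖ := by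
            rw [norm_mul, mul_comm]
            have : ‖1 - E t‖ ≤ 1 + exp x := by
              refine (norm_sub_le _ _).trans ?_
              rw [norm_one]; linarith [hcon.1]
            gcongr
          have h3 := norm_add_le (T c N1 t) (T c2 M t)
          have h4 := norm_le_norm_add_norm_sub (f t * (1 - E t)) (T c N1 t)
          linarith [hcon.2]
        have hM2 := markov_sq (T_cont c2 M) hδ hδ1 (by positivity) hK (hL2 M)
        have hM1 := markov_E hb hx (fun t => (hE t).1) (by linarith)
        calc _ ≤ _ := measureReal_mono hsub
          _ ≤ _ := measureReal_union_le _ _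
          _ ≤ _ := add_le_add hM1 hM2
    · simp only [ContinuousMap.coe_mk]
      push_cast; linarith

lemma block {Λ : Set ℤ} (hΛ : IsSeg Λ) (f : C(TT, ℂ)) {b δ : ℝ} (hb : 0 ≤ b) (hδ : 0 < δ)
    (hδ1 : δ ≤ 1) (N : ℕ) :
    ∃ (N' : ℕ) (c : ℤ → ℂ), N ≤ N' ∧ Supp Λ c N N' ∧
      mu.real {t | exp (-b) * ‖f t‖ + δ < ‖f t - T c N' t‖} ≤ δ ∧
      (∀ M x, 0 < x → mu.real {t | (1 + exp x) * ‖f t‖ + 2 * δ < ‖T c M t‖} ≤ (b + 3) / x + δ) := by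
  obtain ⟨B, hBdef⟩ : ∃ B, B = 2 * (b + 3) / δ := ⟨_, rfl⟩
  have hB : 0 < B := by rw [hBdef]; positivity
  obtain ⟨G, hG⟩ : ∃ G, G = ‖f‖ * exp (B + 2) := ⟨_, rfl⟩
  have hG0 : 0 ≤ G := by rw [hG]; positivity
  obtain ⟨r, hr, hr2, hrG⟩ : ∃ r : ℝ, 0 < r ∧ r ≤ 1 / 2 ∧ G * r ≤ δ ^ 2 / 2 := by
    refine ⟨min (1 / 2) (δ ^ 2 / (2 * (G + 1))), by positivity, min_le_left _ _, ?_⟩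
    calc G * _ ≤ (G + 1) * (δ ^ 2 / (2 * (G + 1))) := by
          gcongr
          · linarith
          · exact min_le_right _ _
      _ = δ ^ 2 / 2 := by field_simp
  obtain ⟨s, hs⟩ : ∃ s, s = r ^ 2 * exp (-b) ^ 2 * (δ / 2) := ⟨_, rfl⟩
  have hs0 : 0 < s := by rw [hs]; positivity
  obtain ⟨n, hn⟩ := exists_nat_gt (exp (B + 2) ^ 2 / (s / 2))
  rw [div_lt_iff₀ (by positivity)] at hn
  obtain ⟨ε, hε, hε1, hε2, hε3⟩ : ∃ ε : ℝ, 0 < ε ∧ ε ≤ s / 2 ∧ ε ≤ δ ^ 2 / 2 ∧ n * ε ≤ δ := by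
    refine ⟨min (min (s / 2) (δ ^ 2 / 2)) (δ / (n + 1)), by positivity,
      (min_le_left _ _).trans (min_le_left _ _), (min_le_left _ _).trans (min_le_right _ _), ?_⟩
    calc n * _ ≤ (n + 1) * (δ / (n + 1)) := by
          gcongr
          · linarith
          · exact min_le_right _ _
      _ = δ := by field_simp
  obtain ⟨E, N', c, hN, hS, hE, hfE, hlog, hpart, halt⟩ :=
    process (τ := δ / 2) hΛ f (fun t => f.norm_coe_le_norm t) hb hB.le hr hr2 hε hδ hδ1
      (by rw [← hG]; linarith) N n hε3
  refine ⟨N', c, hN, hS, ?_, hpart⟩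
  have h1 : mu.real {t | exp (-b) ≤ ‖E t‖ ∧ ‖E t‖ ≤ exp B} < δ / 2 := by
    refine halt.resolve_right (not_le.2 ?_)
    rw [← hs]
    have h2 : ∫ t, ‖E t‖ ^ 2 ∂mu ≤ ∫ t : TT, exp (B + 2) ^ 2 ∂mu := by
      refine integral_mono (cont_integrableR (by fun_prop)) (integrable_const _) fun t => ?_
      have := (hE t).2
      simp only
      gcongr
    simp only [integral_const, probReal_univ, smul_eq_mul, one_mul] at h2
    have h3 : (n : ℝ) * (s / 2) ≤ n * (s - ε) := by gcongr; linarith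
    linarith
  have h2 := markov_E hb hB (fun t => (hE t).1) (by linarith)
  have h3 : (b + 3) / B = δ / 2 := by rw [hBdef]; field_simp
  have hsub : {t | exp (-b) * ‖f t‖ + δ < ‖f t - T c N' t‖} ⊆
      {t | exp (-b) ≤ ‖E t‖ ∧ ‖E t‖ ≤ exp B} ∪ {t | exp B < ‖E t‖} := by
    intro t ht
    by_contra hcon
    simp only [Set.mem_union, Set.mem_ofPred_eq, not_or, not_and, not_le, not_lt] at hcon ht
    have h4 : ‖E t‖ < exp (-b) := by
      by_contra h5
      exact absurd (hcon.1 (not_lt.1 h5)) (not_lt.2 hcon.2)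
    have h5 := hfE t
    have h6 : f t - T c N' t = f t * E t + (f t * (1 - E t) - T c N' t) := by ring
    have h7 : ‖f t * E t‖ ≤ exp (-b) * ‖f t‖ := by
      rw [norm_mul, mul_comm]; gcongr
    rw [h6] at ht
    linarith [norm_add_le (f t * E t) (f t * (1 - E t) - T c N' t)]
  calc _ ≤ _ := measureReal_mono hsub
    _ ≤ _ := measureReal_union_le _ _
    _ ≤ δ := by linarith

lemma approx {f : TT → ℂ} (hf : Measurable f) {ε : ℝ} (hε : 0 < ε) :
    ∃ g : C(TT, ℂ), mu.real {t | ε < ‖f t - g t‖} ≤ ε := by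
  have hm : ∀ n : ℕ, MeasurableSet {t | ‖f t‖ ≤ n} := fun n =>
    measurableSet_le hf.norm measurable_const
  have h1 : TendstoInMeasure mu (fun (n : ℕ) => Set.indicator {t | ‖f t‖ ≤ n} f) atTop f := by
    refine tendstoInMeasure_of_tendsto_ae
      (fun n => (hf.indicator (hm n)).aestronglyMeasurable)
      (Eventually.of_forall fun t => ?_)
    obtain ⟨k, hk⟩ := exists_nat_ge ‖f t‖
    refine tendsto_const_nhds.congr' ?_
    filter_upwards [eventually_ge_atTop k] with n hn
    rw [Set.indicator_of_mem]
    exact hk.trans (by exact_mod_cast hn)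
  have h2 := tendstoInMeasure_iff_measureReal_norm.1 h1 (ε / 2) (by positivity)
  obtain ⟨n, hn⟩ := ((tendsto_order.1 h2).2 (ε / 2) (by positivity)).exists
  have hint : Integrable (Set.indicator {t | ‖f t‖ ≤ n} f) mu := by
    refine Integrable.of_bound (hf.indicator (hm n)).aestronglyMeasurable n
      (Eventually.of_forall fun t => ?_)
    by_cases ht : t ∈ {t | ‖f t‖ ≤ n}
    · rw [Set.indicator_of_mem ht]; exact ht
    · rw [Set.indicator_of_notMem ht, norm_zero]; positivity
  obtain ⟨g, hg, -⟩ := hint.exists_boundedContinuous_integral_sub_le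
    (show 0 < (ε / 2) ^ 2 by positivity)
  refine ⟨g, ?_⟩
  have h3 := mul_meas_ge_le_integral_of_nonneg (μ := mu)
    (f := fun t => ‖Set.indicator {t | ‖f t‖ ≤ n} f t - g t‖)
    (Eventually.of_forall fun t => norm_nonneg _)
    (hint.sub (cont_integrable g.continuous)).norm (ε / 2)
  have h4 : (ε / 2) * mu.real {t | ε / 2 ≤ ‖Set.indicator {t | ‖f t‖ ≤ n} f t - g t‖}
    ≤ (ε / 2) * (ε / 2) := by nlinarith
  have h5 := le_of_mul_le_mul_left h4 (by positivity)
  have hsub : {t | ε < ‖f t - g t‖} ⊆ {t | ε / 2 ≤ ‖Set.indicator {t | ‖f t‖ ≤ n} f t - f t‖} ∪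
      {t | ε / 2 ≤ ‖Set.indicator {t | ‖f t‖ ≤ n} f t - g t‖} := by
    intro t ht
    by_contra hcon
    simp only [Set.mem_union, Set.mem_ofPred_eq, not_or, not_le] at hcon ht
    have h6 := norm_sub_le_norm_sub_add_norm_sub (f t) (Set.indicator {t | ‖f t‖ ≤ n} f t) (g t)
    rw [norm_sub_rev (f t)  (Set.indicator _ _ _)] at h6
    linarith
  calc mu.real {t | ε < ‖f t - g t‖} ≤ _ := measureReal_mono hsub
    _ ≤ _ := measureReal_union_le _ _
    _ ≤ ε := by linarith

lemma exp_neg_three : exp (-3) ≤ 1 / 8 := by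
  have h1 : (2 : ℝ) ≤ exp 1 := by linarith [Real.add_one_le_exp 1]
  have h2 : exp 3 = exp 1 ^ 3 := by rw [← Real.exp_nat_mul]; norm_num
  have h3 : (2 : ℝ) ^ 3 ≤ exp 1 ^ 3 := by gcongr
  rw [exp_neg, h2, one_div]
  gcongr
  linarith

lemma stage {Λ : Set ℤ} (hΛ : IsSeg Λ) {f : TT → ℂ} (hf : Measurable f) {ρ : ℝ} (hρ : 0 < ρ)
    (hρ1 : ρ ≤ 1) (N : ℕ) :
    ∃ (N' : ℕ) (c : ℤ → ℂ), N < N' ∧ Supp Λ c N N' ∧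
      mu.real {t | ρ / 2 < ‖f t - T c N' t‖} ≤ ρ / 2 ∧
      (mu.real {t | ρ < ‖f t‖} ≤ ρ → ∀ M x, 0 < x →
        mu.real {t | (1 + exp x) * (2 * ρ) + ρ < ‖T c M t‖} ≤ 6 / x + 2 * ρ) := by
  obtain ⟨δ, hδd⟩ : ∃ δ, δ = ρ / 16 := ⟨_, rfl⟩
  have hδ : 0 < δ := by rw [hδd]; positivity
  have hδ1 : δ ≤ 1 := by linarith
  obtain ⟨f1, hf1⟩ := approx hf hδ
  have hmax : ∀ t, 0 < max (2 * ρ) ‖f1 t‖ := fun t => lt_max_of_lt_left (by positivity)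
  let g : C(TT, ℂ) := ⟨fun t => f1 t * ((2 * ρ / max (2 * ρ) ‖f1 t‖ : ℝ) : ℂ), by
    have : Continuous fun t => 2 * ρ / max (2 * ρ) ‖f1 t‖ :=
      Continuous.div (by fun_prop) (by fun_prop) fun t => (hmax t).ne'
    fun_prop⟩
  have hgn : ∀ t, ‖g t‖ ≤ 2 * ρ := by
    intro t
    change ‖f1 t * ((2 * ρ / max (2 * ρ) ‖f1 t‖ : ℝ) : ℂ)‖ ≤ _
    rw [norm_mul, Complex.norm_real, Real.norm_eq_abs, abs_of_nonneg (div_nonneg (by positivity)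
      (hmax t).le), mul_div_assoc', div_le_iff₀ (hmax t), mul_comm]
    gcongr
    exact le_max_right _ _
  have hgeq : ∀ t, ‖f1 t‖ ≤ 2 * ρ → g t = f1 t := by
    intro t ht
    change f1 t * ((2 * ρ / max (2 * ρ) ‖f1 t‖ : ℝ) : ℂ) = _
    rw [max_eq_left ht, div_self (by positivity), Complex.ofReal_one, mul_one]
  obtain ⟨h, hh⟩ : ∃ h : C(TT, ℂ), h = f1 - g := ⟨_, rfl⟩
  have hht : ∀ t, h t = f1 t - g t := fun t => by rw [hh]; rfl
  obtain ⟨b, hb, hbh⟩ : ∃ b : ℝ, 0 ≤ b ∧ ∀ t, exp (-b) * ‖h t‖ ≤ δ := by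
    refine ⟨‖h‖ / δ, by positivity, fun t => ?_⟩
    have h1 := h.norm_coe_le_norm t
    have h2 := Real.add_one_le_exp (‖h‖ / δ)
    rw [exp_neg, inv_mul_le_iff₀ (exp_pos _)]
    have h3 : ‖h‖ / δ * δ ≤ exp (‖h‖ / δ) * δ := by gcongr; linarith
    rw [div_mul_cancel₀ _ hδ.ne'] at h3
    linarith
  obtain ⟨N1, c1, hN1, hS1, hr1, hp1⟩ := block hΛ h hb hδ hδ1 N
  obtain ⟨N2, c2, hN2, hS2, hr2, hp2⟩ := block hΛ g (b := 3) (by norm_num) hδ hδ1 N1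
  refine ⟨N2 + 1, c1 + c2, by omega,
    (hS1.mono le_rfl (by omega)).add (hS2.mono hN1 (by omega)), ?_, ?_⟩
  · have hsub : {t | ρ / 2 < ‖f t - T (c1 + c2) (N2 + 1) t‖} ⊆ {t | δ < ‖f t - f1 t‖} ∪
        ({t | exp (-b) * ‖h t‖ + δ < ‖h t - T c1 N1 t‖} ∪
        {t | exp (-3) * ‖g t‖ + δ < ‖g t - T c2 N2 t‖}) := by
      intro t ht
      by_contra hcon
      simp only [Set.mem_union, Set.mem_ofPred_eq, not_or, not_lt] at hcon ht
      rw [T_add, T_of_ge hS1 (by omega), T_of_ge hS2 (by omega)] at ht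
      have e : f t - (T c1 N1 t + T c2 N2 t) =
        (f t - f1 t) + (h t - T c1 N1 t) + (g t - T c2 N2 t) := by rw [hht]; ring
      rw [e] at ht
      have h1 := norm_add₃_le (a := f t - f1 t) (b := h t - T c1 N1 t) (c := g t - T c2 N2 t)
      have h2 := hbh t
      have h3 : exp (-3) * ‖g t‖ ≤ 1 / 8 * (2 * ρ) :=
        mul_le_mul exp_neg_three (hgn t) (norm_nonneg _) (by norm_num)
      obtain ⟨h4, h5, h6⟩ := hcon
      linarith
    calc _ ≤ _ := measureReal_mono hsub
      _ ≤ _ := measureReal_union_le _ _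
      _ ≤ δ + (δ + δ) := add_le_add hf1 ((measureReal_union_le _ _).trans (add_le_add hr1 hr2))
      _ ≤ ρ / 2 := by linarith
  · intro hbad M x hx
    have hy : 0 < (b + 3) / δ := by positivity
    have hp1 := hp1 M _ hy
    have hp2 := hp2 M x hx
    rw [div_div_cancel₀ (by positivity)] at hp1
    have hsub : {t | (1 + exp x) * (2 * ρ) + ρ < ‖T (c1 + c2) M t‖} ⊆
        ({t | (1 + exp ((b + 3) / δ)) * ‖h t‖ + 2 * δ < ‖T c1 M t‖} ∪
        {t | (1 + exp x) * ‖g t‖ + 2 * δ < ‖T c2 M t‖}) ∪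
        ({t | ρ < ‖f t‖} ∪ {t | δ < ‖f t - f1 t‖}) := by
      intro t ht
      by_contra hcon
      simp only [Set.mem_union, Set.mem_ofPred_eq, not_or, not_lt] at hcon ht
      obtain ⟨⟨h1, h2⟩, h3, h4⟩ := hcon
      have h5 : ‖f1 t‖ ≤ 2 * ρ := by
        have := norm_le_norm_add_norm_sub (f t) (f1 t)
        linarith
      have h6 : h t = 0 := by rw [hht, hgeq t h5, sub_self]
      rw [h6, norm_zero, mul_zero, zero_add] at h1
      have h7 : (1 + exp x) * ‖g t‖ ≤ (1 + exp x) * (2 * ρ) := by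
        have := hgn t
        gcongr
      rw [T_add] at ht
      have h8 := norm_add_le (T c1 M t) (T c2 M t)
      linarith
    have e3 : ((3 : ℝ) + 3) / x = 6 / x := by norm_num
    rw [e3] at hp2
    calc _ ≤ _ := measureReal_mono hsub
      _ ≤ _ := measureReal_union_le _ _
      _ ≤ _ := add_le_add (measureReal_union_le _ _) (measureReal_union_le _ _)
      _ ≤ 6 / x + 2 * ρ := by linarith

lemma main {Λ : Set ℤ} (hΛ : IsSeg Λ) {f : TT → ℂ} (hf : Measurable f) :
    ∃ c : ℤ → ℂ, (∀ k, c k ≠ 0 → k ∈ Λ) ∧ TendstoInMeasure mu (fun N => T c N) atTop f := by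
  have hst : ∀ (n : ℕ) (N : ℕ) (C : ℤ → ℂ), ∃ (N' : ℕ) (c : ℤ → ℂ), N < N' ∧ Supp Λ c N N' ∧
      mu.real {t | (1 / 2 : ℝ) ^ n / 2 < ‖f t - T C N t - T c N' t‖} ≤ (1 / 2 : ℝ) ^ n / 2 ∧
      (mu.real {t | (1 / 2 : ℝ) ^ n < ‖f t - T C N t‖} ≤ (1 / 2 : ℝ) ^ n → ∀ M x, 0 < x →
        mu.real {t | (1 + exp x) * (2 * (1 / 2 : ℝ) ^ n) + (1 / 2 : ℝ) ^ n < ‖T c M t‖}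
          ≤ 6 / x + 2 * (1 / 2 : ℝ) ^ n) := fun n N C =>
    stage hΛ (f := fun t => f t - T C N t) (hf.sub (T_cont C N).measurable)
      (by positivity) (pow_le_one₀ (by norm_num) (by norm_num)) N
  choose Nf cf hlt hsupp hres hpar using hst
  let s : ℕ → ℕ × (ℤ → ℂ) := fun n => Nat.rec (0, 0)
    (fun n p => (Nf n p.1 p.2, p.2 + cf n p.1 p.2)) n
  obtain ⟨Ns, hNs⟩ : ∃ Ns : ℕ → ℕ, Ns = fun n => (s n).1 := ⟨_, rfl⟩
  obtain ⟨C, hC⟩ : ∃ C : ℕ → ℤ → ℂ, C = fun n => (s n).2 := ⟨_, rfl⟩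
  have hN0 : Ns 0 = 0 := by rw [hNs]; rfl
  have hC0 : C 0 = 0 := by rw [hC]; rfl
  have hNS : ∀ n, Ns (n + 1) = Nf n (Ns n) (C n) := fun n => by rw [hNs, hC]
  have hCS : ∀ n, C (n + 1) = C n + cf n (Ns n) (C n) := fun n => by rw [hNs, hC]
  have hmono : StrictMono Ns := strictMono_nat_of_lt_succ fun n => by
    rw [hNS]; exact hlt _ _ _
  have hsup : ∀ n, Supp Λ (cf n (Ns n) (C n)) (Ns n) (Ns (n + 1)) := fun n => by
    rw [hNS]; exact hsupp _ _ _
  have hCsup : ∀ n, Supp Λ (C n) 0 (Ns n) := by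
    intro n
    induction n with
    | zero => rw [hC0]; exact fun k hk => absurd rfl hk
    | succ n ih =>
      rw [hCS]
      exact (ih.mono le_rfl (hmono.monotone (Nat.le_succ n))).add ((hsup n).mono (Nat.zero_le _) le_rfl)
  have hstab : ∀ n m, n ≤ m → ∀ k : ℤ, k ≤ Ns n → C m k = C n k := by
    intro n m hnm
    induction m, hnm using Nat.le_induction with
    | base => intro k _; rfl
    | succ m hm ih =>
      intro k hk
      rw [hCS, Pi.add_apply, ih k hk]
      have : cf m (Ns m) (C m) k = 0 := by
        by_contra hne
        have h1 := (hsup m k hne).2.1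
        have h2 := hmono.monotone hm
        omega
      rw [this, add_zero]
  obtain ⟨c, hc⟩ : ∃ c : ℤ → ℂ, c = fun k => C k.toNat k := ⟨_, rfl⟩
  have hcC : ∀ n (k : ℤ), k ≤ Ns n → c k = C n k := by
    intro n k hk
    have h1 : k ≤ Ns k.toNat := by
      have := hmono.id_le k.toNat
      simp only [id] at this
      omega
    rw [hc]
    simp only
    rw [← hstab k.toNat (max n k.toNat) (le_max_right _ _) k h1,
      hstab n (max n k.toNat) (le_max_left _ _) k hk]
  have hTc : ∀ n M, M ≤ Ns n → ∀ t, T c M t = T (C n) M t := by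
    intro n M hM t
    refine Finset.sum_congr rfl fun k hk => ?_
    rw [Finset.mem_Icc] at hk
    rw [hcC n k (by omega)]
  have hinv : ∀ n, mu.real {t | (1 / 2 : ℝ) ^ (n + 1) < ‖f t - T (C (n + 1)) (Ns (n + 1)) t‖}
      ≤ (1 / 2 : ℝ) ^ (n + 1) := by
    intro n
    have h1 := hres n (Ns n) (C n)
    have e : (1 / 2 : ℝ) ^ (n + 1) = (1 / 2 : ℝ) ^ n / 2 := by rw [pow_succ]; ring
    rw [e]
    have e2 : ∀ t, f t - T (C (n + 1)) (Ns (n + 1)) t = f t - T (C n) (Ns n) t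
        - T (cf n (Ns n) (C n)) (Nf n (Ns n) (C n)) t := fun t => by
      rw [hCS, T_add, hNS n, T_of_ge (hCsup n) (hlt _ _ _).le]
      ring
    simp_rw [e2]
    exact h1
  refine ⟨c, ?_, ?_⟩
  · intro k hk
    rw [hc] at hk
    exact (hCsup _ k hk).1
  · rw [tendstoInMeasure_iff_measureReal_norm]
    intro ε hε
    rw [Metric.tendsto_atTop]
    intro η hη
    obtain ⟨x, hx⟩ : ∃ x, x = 12 / η := ⟨_, rfl⟩
    have hx0 : 0 < x := by rw [hx]; positivity
    obtain ⟨n0, hn0⟩ := exists_pow_lt_of_lt_one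
      (show 0 < min (ε / (4 + 2 * exp x)) (η / 6) by positivity) (show (1 / 2 : ℝ) < 1 by norm_num)
    refine ⟨Ns (n0 + 1), fun M hM => ?_⟩
    have hex : ∃ n, M < Ns (n + 1) := ⟨M, by
      have := hmono.id_le (M + 1)
      simp only [id] at this
      omega⟩
    classical
    obtain ⟨n, hn1, hn2⟩ : ∃ n, M < Ns (n + 1) ∧ Ns n ≤ M := by
      refine ⟨Nat.find hex, Nat.find_spec hex, ?_⟩
      rcases Nat.eq_zero_or_pos (Nat.find hex) with h | h
      · rw [h, hN0]; exact Nat.zero_le _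
      · have := Nat.find_min hex (m := Nat.find hex - 1) (by omega)
        rw [Nat.sub_add_cancel h] at this
        omega
    have hnn : n0 + 1 ≤ n := by
      by_contra hcon
      have := hmono.monotone (show n + 1 ≤ n0 + 1 by omega)
      omega
    have hρ : (1 / 2 : ℝ) ^ n < min (ε / (4 + 2 * exp x)) (η / 6) :=
      (pow_le_pow_of_le_one (by norm_num) (by norm_num) (by omega)).trans_lt hn0
    have hi : mu.real {t | (1 / 2 : ℝ) ^ n < ‖f t - T (C n) (Ns n) t‖} ≤ (1 / 2 : ℝ) ^ n := by
      obtain ⟨m, rfl⟩ : ∃ m, n = m + 1 := ⟨n - 1, by omega⟩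
      exact hinv m
    have hp := hpar n (Ns n) (C n) hi M x hx0
    obtain ⟨ρ, hρd⟩ : ∃ ρ : ℝ, ρ = (1 / 2 : ℝ) ^ n := ⟨_, rfl⟩
    have hρ0 : 0 < ρ := by rw [hρd]; positivity
    rw [← hρd] at hρ hi hp
    have hρ1 := hρ.trans_le (min_le_left _ _)
    have hρ2 := hρ.trans_le (min_le_right _ _)
    rw [lt_div_iff₀ (by positivity)] at hρ1
    have hsub : {t | ε ≤ ‖T c M t - f t‖} ⊆ {t | ρ < ‖f t - T (C n) (Ns n) t‖} ∪
        {t | (1 + exp x) * (2 * ρ) + ρ < ‖T (cf n (Ns n) (C n)) M t‖} := by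
      intro t ht
      by_contra hcon
      simp only [Set.mem_union, Set.mem_ofPred_eq, not_or, not_lt] at hcon ht
      have e : f t - T c M t = (f t - T (C n) (Ns n) t) - T (cf n (Ns n) (C n)) M t := by
        rw [hTc (n + 1) M hn1.le, hCS, T_add, T_of_ge (hCsup n) hn2]; ring
      rw [norm_sub_rev, e] at ht
      have h1 := norm_sub_le (f t - T (C n) (Ns n) t) (T (cf n (Ns n) (C n)) M t)
      nlinarith [hcon.1, hcon.2]
    rw [dist_zero_right, Real.norm_eq_abs, abs_of_nonneg measureReal_nonneg]
    have e6 : 6 / x = η / 2 := by rw [hx]; field_simp; norm_num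
    calc _ ≤ _ := measureReal_mono hsub
      _ ≤ _ := measureReal_union_le _ _
      _ ≤ _ := add_le_add hi hp
      _ < η := by rw [e6]; linarith

end Seg

/-- **Theorem 7**: if `Λ ⊆ ℤ⁺` contains arbitrarily long segments of consecutive
integers, then every measurable `f : 𝕋 → ℂ` admits a representation
`f(t) = ∑_{k ∈ Λ} c_k e^{ikt}` converging in measure. -/
theorem analytic_representation_of_segments (Λ : Set ℤ)
    (hpos : Λ ⊆ {n : ℤ | 0 < n})
    (hseg : ∀ L : ℕ, ∃ a : ℤ, 0 < a ∧ ∀ i : ℕ, i ≤ L → a + (i : ℤ) ∈ Λ) :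
    ∀ f : AddCircle (2 * π) → ℂ, Measurable f →
      ∃ c : ℤ → ℂ,
        TendstoInMeasure volume (fun N => lambdaPartialSum Λ c N) atTop f := by
  intro f hf
  have hΛ : Seg.IsSeg Λ := by
    intro L N
    obtain ⟨a, ha, h⟩ := hseg (N.toNat + 2 * L)
    refine ⟨a + N.toNat + L, by omega, fun i hi => ?_⟩
    rw [abs_le] at hi
    have := h (N.toNat + L + i).toNat (by omega)
    convert this using 1
    omega
  obtain ⟨c, hc, ht⟩ := Seg.main hΛ hf
  refine ⟨c, ?_⟩
  have e : (fun N => lambdaPartialSum Λ c N) = fun N => Seg.T c N := by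
    have : Λ.indicator c = c := by
      rw [Set.indicator_eq_self]
      intro k hk
      exact hc k hk
    funext N t
    simp only [lambdaPartialSum, Seg.T, this]
  rw [e]
  intro ε hε
  have h := ENNReal.Tendsto.const_mul (a := ENNReal.ofReal (2 * π)) (ht ε hε)
    (Or.inr ENNReal.ofReal_ne_top)
  rw [mul_zero] at h
  rw [AddCircle.volume_eq_smul_haarAddCircle]
  simpa only [Measure.smul_apply, smul_eq_mul] using h
end
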